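/- The measure μ* is T-invariant, ergodic with respect to T, and non-atomic (no single point of X carries positive μ*-mass), and its support equals J̃. -/

import Mathlib

open MeasureTheory Filter Topology Polynomial
open scoped OnePoint Classical ENNReal

noncomputable section

namespace SkewRational

/-- The Riemann sphere, modelled as the one-point compactification of `ℂ`. -/
abbrev Sphere : Type := OnePoint ℂ

/-- The product space `X = Σ_N⁺ × ℂ̂`. -/
abbrev SymX (N : ℕ) : Type := (ℕ → Fin N) × Sphere

variable {N : ℕ}

/-- The left shift on `Σ_N⁺`. -/
def shiftW (w : ℕ → Fin N) : ℕ → Fin N := fun n => w (n + 1)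

/-- Prepending a letter to an infinite word. -/
def consW (v : Fin N) (w : ℕ → Fin N) : ℕ → Fin N := fun n => if n = 0 then v else w (n - 1)

/-- Evaluation of the rational map `P/Q` (in irreducible form) on the Riemann sphere. -/
def ratEval (P Q : ℂ[X]) : Sphere → Sphere := fun z =>
  OnePoint.elim z
    (if Q.natDegree < P.natDegree then (OnePoint.infty : Sphere)
     else if P.natDegree < Q.natDegree then ((0 : ℂ) : Sphere)
     else ((P.leadingCoeff / Q.leadingCoeff : ℂ) : Sphere))
    (fun a => if Q.eval a = 0 then (OnePoint.infty : Sphere) else ((P.eval a / Q.eval a : ℂ) : Sphere))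

/-- The multiset of preimages (with multiplicity) of a point of the sphere under `P/Q`. -/
def fiber (P Q : ℂ[X]) (a : Sphere) : Multiset Sphere :=
  OnePoint.elim a
    ((Q.roots.map fun z => (z : Sphere)) +
      Multiset.replicate (max P.natDegree Q.natDegree - Q.natDegree) (OnePoint.infty : Sphere))
    (fun b =>
      (((P - Polynomial.C b * Q).roots.map fun z => (z : Sphere)) +
        Multiset.replicate
          (max P.natDegree Q.natDegree - (P - Polynomial.C b * Q).natDegree) (OnePoint.infty : Sphere)))

variable (p q : Fin N → ℂ[X])

/-- The degree `d_i` of the rational map `R_i = p i / q i`. -/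
def degR (i : Fin N) : ℕ := max (p i).natDegree (q i).natDegree

/-- `D = d₁ + ⋯ + d_N`. -/
def Dtot : ℕ := ∑ i, degR p q i

/-- Standing assumptions: `N ≥ 1`, each `R_i = p i / q i` in irreducible form, all degrees
at least `1`, and at least one degree at least `2`. -/
def Good : Prop :=
  1 ≤ N ∧ (∀ i, IsCoprime (p i) (q i)) ∧ (∀ i, 1 ≤ degR p q i) ∧ (∃ i, 2 ≤ degR p q i)

/-- The skew-product map `T(w, z) = (σ w, R_{w 0} z)`. -/
def Tmap : SymX N → SymX N := fun x => (shiftW x.1, ratEval (p (x.1 0)) (q (x.1 0)) x.2)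

/-- The multiset of preimages of a point under `T`, counted with multiplicity. -/
def preimT (x : SymX N) : Multiset (SymX N) :=
  ∑ v : Fin N, (fiber (p v) (q v) x.2).map fun z => (consW v x.1, z)

/-- The multiset of `n`-th order preimages under `T^n`, counted with multiplicity. -/
def preimTn : ℕ → SymX N → Multiset (SymX N)
  | 0, x => {x}
  | n + 1, x => (preimT p q x).bind fun y => preimTn n y

/-- The chordal (spherical) metric on the Riemann sphere. -/
def sphDist : Sphere → Sphere → ℝ := fun z w =>
  OnePoint.elim z
    (OnePoint.elim w 0 fun b => 2 / Real.sqrt (1 + ‖b‖ ^ 2))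
    (fun a =>
      OnePoint.elim w (2 / Real.sqrt (1 + ‖a‖ ^ 2))
        (fun b => 2 * dist a b / (Real.sqrt (1 + ‖a‖ ^ 2) * Real.sqrt (1 + ‖b‖ ^ 2))))

/-- The metric `d(w, w') = 2^{-n(w,w')}` on `Σ_N⁺`. -/
def shiftDist (w w' : ℕ → Fin N) : ℝ :=
  if h : ∃ n, w n ≠ w' n then (2 : ℝ)⁻¹ ^ (Nat.find h + 1) else 0

/-- The metric on `X`: maximum of the two coordinate metrics. -/
def dX : SymX N → SymX N → ℝ := fun x y => max (shiftDist x.1 y.1) (sphDist x.2 y.2)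

/-- Montel normality of a family of self-maps of the sphere on a set `U`. -/
def NormalOn (F : Set (Sphere → Sphere)) (U : Set Sphere) : Prop :=
  ∀ s : ℕ → Sphere → Sphere, (∀ n, s n ∈ F) →
    ∃ φ : ℕ → ℕ, StrictMono φ ∧ ∃ g : Sphere → Sphere,
      ∀ K : Set Sphere, K ⊆ U → IsCompact K → ∀ ε : ℝ, 0 < ε →
        ∀ᶠ n in atTop, ∀ z ∈ K, sphDist (s (φ n) z) (g z) < ε

/-- The compositions `R_{w (n-1)} ∘ ⋯ ∘ R_{w 0}`. -/
def itComp (w : ℕ → Fin N) : ℕ → Sphere → Sphere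
  | 0 => id
  | n + 1 => ratEval (p (w n)) (q (w n)) ∘ itComp w n

/-- The fibrewise Fatou set `F_w`. -/
def fatouW (w : ℕ → Fin N) : Set Sphere :=
  {z | ∃ U : Set Sphere, IsOpen U ∧ z ∈ U ∧
    NormalOn {g | ∃ n, 1 ≤ n ∧ g = itComp p q w n} U}

/-- The fibrewise Julia set `J_w`. -/
def juliaW (w : ℕ → Fin N) : Set Sphere := (fatouW p q w)ᶜ

/-- The Julia set `J̃` of the skew-product map `T`. -/
def juliaSet : Set (SymX N) :=
  closure (⋃ w : ℕ → Fin N, {w} ×ˢ juliaW p q w)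

/-- The critical points of `T`: `(w, z)` with `z` a critical point of `R_{w 0}`. -/
def critSet : Set (SymX N) :=
  {x | 2 ≤ (fiber (p (x.1 0)) (q (x.1 0))
        (ratEval (p (x.1 0)) (q (x.1 0)) x.2)).count x.2}

/-- Assumption (A1): no super-attracting periodic point of `T` lies in the Julia set
(a periodic point is super-attracting exactly when its orbit meets the critical set,
i.e. the derivative of the return composition vanishes). -/
def NoSuperAttract : Prop :=
  ∀ x ∈ juliaSet p q, ∀ m : ℕ, 1 ≤ m → (Tmap p q)^[m] x = x →
    ∀ k < m, (Tmap p q)^[k] x ∉ critSet p q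

instance : MeasurableSpace (SymX N) := borel _
instance : BorelSpace (SymX N) := ⟨rfl⟩

instance : MeasurableSpace ↥(juliaSet p q) := borel _
instance : BorelSpace ↥(juliaSet p q) := ⟨rfl⟩

/-! ### Fixed points counted with multiplicity -/

/-- Formal composition of rational maps as pairs of polynomials: `compPair a b = a ∘ b`. -/
def compPair (a b : ℂ[X] × ℂ[X]) : ℂ[X] × ℂ[X] :=
  (∑ i ∈ Finset.range (max a.1.natDegree a.2.natDegree + 1),
      Polynomial.C (a.1.coeff i) * b.1 ^ i * b.2 ^ (max a.1.natDegree a.2.natDegree - i),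
   ∑ i ∈ Finset.range (max a.1.natDegree a.2.natDegree + 1),
      Polynomial.C (a.2.coeff i) * b.1 ^ i * b.2 ^ (max a.1.natDegree a.2.natDegree - i))

/-- For a word `[v₁, …, v_m]`, the composite `R_{v_m} ∘ ⋯ ∘ R_{v₁}` as a pair of
polynomials. -/
def wordPair : List (Fin N) → ℂ[X] × ℂ[X]
  | [] => (Polynomial.X, 1)
  | v :: t => compPair (wordPair t) (p v, q v)

/-- The multiset of fixed points (with multiplicity) on the sphere of the rational map given
by a pair of polynomials; a degree-`k` map has `k + 1` fixed points with multiplicity. -/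
def fixMul (a : ℂ[X] × ℂ[X]) : Multiset Sphere :=
  ((a.1 - Polynomial.X * a.2).roots.map fun z => (z : Sphere)) +
    Multiset.replicate
      (max a.1.natDegree a.2.natDegree + 1 - (a.1 - Polynomial.X * a.2).natDegree) (OnePoint.infty : Sphere)

/-- The periodic word `(v₁ ⋯ v_m v₁ ⋯ v_m ⋯)`. -/
def perW {m : ℕ} (hm : 0 < m) (v : Fin m → Fin N) : ℕ → Fin N :=
  fun n => v ⟨n % m, Nat.mod_lt n hm⟩

/-- The multiset `Fix_m(T)` of fixed points of `T^m`, counted with multiplicity. -/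
def fixMultiset (m : ℕ) : Multiset (SymX N) :=
  if hm : 0 < m then
    ∑ v : Fin m → Fin N, (fixMul (wordPair p q (List.ofFn v))).map fun z => (perW hm v, z)
  else 0

/-! ### Thermodynamic formalism -/

/-- The ergodic (Birkhoff) sum `f^n`. -/
def birk (f : SymX N → ℝ) (n : ℕ) (y : SymX N) : ℝ :=
  ∑ k ∈ Finset.range n, f ((Tmap p q)^[k] y)

/-- `(L_f^n 1)(x) = Σ_{T^n y = x} e^{f^n(y)}`. -/
def LSum (f : SymX N → ℝ) (n : ℕ) (x : SymX N) : ℝ :=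
  ((preimTn p q n x).map fun y => Real.exp (birk p q f n y)).sum

/-- The pressure `P(f) = sup_{x ∈ J̃} limsup (1/n) log (L_f^n 1)(x)`. -/
def pressure (f : SymX N → ℝ) : ℝ :=
  ⨆ x : ↥(juliaSet p q), limsup (fun n : ℕ => (n : ℝ)⁻¹ * Real.log (LSum p q f n ↑x)) atTop

/-- Extension by zero of a function on `J̃` to all of `X`; since `T⁻¹ J̃ = J̃`, the values
outside `J̃` are irrelevant in all expressions below. -/
def jextend (f : ↥(juliaSet p q) → ℝ) : SymX N → ℝ :=
  fun x => if hx : x ∈ juliaSet p q then f ⟨x, hx⟩ else 0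

/-- Hölder continuity on `J̃` with respect to the metric `d_X`. -/
def HolderOnJ (f : ↥(juliaSet p q) → ℝ) : Prop :=
  ∃ C : ℝ, 0 < C ∧ ∃ α : ℝ, α ∈ Set.Ioc (0 : ℝ) 1 ∧
    ∀ x y : ↥(juliaSet p q), |f x - f y| ≤ C * dX (x : SymX N) (y : SymX N) ^ α

/-- `Q(g) = P(f + g) − P(f)`. -/
def Qfun (f g : ↥(juliaSet p q) → ℝ) : ℝ :=
  pressure p q (jextend p q fun x => f x + g x) - pressure p q (jextend p q f)

/-- The Legendre transform `L(m) = sup_g (∫ g dm − Q(g)) ∈ [0, (OnePoint.infty : Sphere)]`. -/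
def LLfun (f : ↥(juliaSet p q) → ℝ) (m : ProbabilityMeasure ↥(juliaSet p q)) : EReal :=
  ⨆ g : C(↥(juliaSet p q), ℝ),
    (((∫ x, g x ∂(m : Measure ↥(juliaSet p q))) - Qfun p q f g : ℝ) : EReal)

/-- `ρ(K) = inf_{m ∈ K} L(m)`. -/
def rho (f : ↥(juliaSet p q) → ℝ) (K : Set (ProbabilityMeasure ↥(juliaSet p q))) : EReal :=
  ⨅ m ∈ K, LLfun p q f m

/-- Membership in `M_T`: `T`-invariance of a probability measure on `J̃`. -/
def MTinv (m : ProbabilityMeasure ↥(juliaSet p q)) : Prop :=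
  ∀ A : Set (SymX N), MeasurableSet A →
    ((m : Measure ↥(juliaSet p q)).map Subtype.val) (Tmap p q ⁻¹' A) =
      ((m : Measure ↥(juliaSet p q)).map Subtype.val) A

/-- The orbital measure `μ_{y,n} = (1/n)(δ_y + δ_{Ty} + ⋯ + δ_{T^{n-1}y})`, viewed as a
measure on `J̃`. -/
def orbMeas (y : SymX N) (n : ℕ) : Measure ↥(juliaSet p q) :=
  Measure.comap Subtype.val
    ((n : ℝ≥0∞)⁻¹ • ∑ k ∈ Finset.range n, Measure.dirac ((Tmap p q)^[k] y))

/-- The (unique, if it exists) probability-measure avatar of `μ` lies in `K`. -/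
def inK (μ : Measure ↥(juliaSet p q)) (K : Set (ProbabilityMeasure ↥(juliaSet p q))) : Prop :=
  ∃ ν : ProbabilityMeasure ↥(juliaSet p q), (ν : Measure ↥(juliaSet p q)) = μ ∧ ν ∈ K

/-- The sequence `(1/n) log [Σ_{T^n y = x, μ_{y,n} ∈ K} e^{f^n(y)} / Σ_{T^n y = x} e^{f^n(y)}]`,
valued in `EReal` with the convention `log 0 = ⊥`. -/
def preimLDSeq (f : ↥(juliaSet p q) → ℝ) (x : SymX N)
    (K : Set (ProbabilityMeasure ↥(juliaSet p q))) : ℕ → EReal := fun n =>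
  if (((preimTn p q n x).filter fun y => inK p q (orbMeas p q y n) K).map
        fun y => Real.exp (birk p q (jextend p q f) n y)).sum = 0 then ⊥
  else
    (((n : ℝ)⁻¹ * Real.log
      (((((preimTn p q n x).filter fun y => inK p q (orbMeas p q y n) K).map
          fun y => Real.exp (birk p q (jextend p q f) n y)).sum) /
        LSum p q (jextend p q f) n x) : ℝ) : EReal)

/-- `Fix_m(T) ∩ J̃` as a multiset. -/
def fixJ (m : ℕ) : Multiset (SymX N) := (fixMultiset p q m).filter fun y => y ∈ juliaSet p q

/-- `Σ_{(ω,ζ) ∈ Fix_m(T) ∩ J̃} e^{f^m(ω,ζ)}`. -/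
def fixSum (f : SymX N → ℝ) (m : ℕ) : ℝ :=
  ((fixJ p q m).map fun y => Real.exp (birk p q f m y)).sum

/-- The periodic-point analogue of `preimLDSeq`, with the convention `log 0 = ⊥`. -/
def fixLDSeq (f : ↥(juliaSet p q) → ℝ)
    (K : Set (ProbabilityMeasure ↥(juliaSet p q))) : ℕ → EReal := fun m =>
  if (((fixJ p q m).filter fun y => inK p q (orbMeas p q y m) K).map
        fun y => Real.exp (birk p q (jextend p q f) m y)).sum = 0 then ⊥
  else
    (((m : ℝ)⁻¹ * Real.log
      (((((fixJ p q m).filter fun y => inK p q (orbMeas p q y m) K).map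
          fun y => Real.exp (birk p q (jextend p q f) m y)).sum) /
        fixSum p q (jextend p q f) m) : ℝ) : EReal)

/-! ### Inverse branches -/

/-- Projection of a subset of `X` to the sphere coordinate. -/
def projC (E : Set (SymX N)) : Set Sphere := Prod.snd '' E

/-- For a word `[v₁, …, v_m]`, the composite map `R_{v₁} ∘ R_{v₂} ∘ ⋯ ∘ R_{v_m}`. -/
def mapWord (l : List (Fin N)) : Sphere → Sphere :=
  l.foldr (fun i f => ratEval (p i) (q i) ∘ f) id

/-- `γ_m(U)`: the total number of analytic inverse branches of `T^m` on `U`, counted over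
all `m`-strings.  (A continuous section of a rational map off its critical values is
automatically holomorphic.) -/
def gammaCount (U : Set (SymX N)) (m : ℕ) : ℕ :=
  Nat.card ((v : Fin m → Fin N) ×
    { s : C(↥(projC U), Sphere) // ∀ z : ↥(projC U), mapWord p q (List.ofFn v) (s z) = ↑z })

/-- `C_n = ⋃_{k=1}^n T^k(C)`, the critical values of `T` of order up to `n`. -/
def critValSet (n : ℕ) : Set (SymX N) :=
  ⋃ k ∈ Finset.Icc 1 n, (Tmap p q)^[k] '' critSet p q

/-- `τ`: the number of distinct critical values of `T` in `U` (projected to the sphere). -/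
def tauCount (U : Set (SymX N)) : ℕ := (Prod.snd '' (Tmap p q '' critSet p q ∩ U)).ncard

/-! ### The averaging operator `G` -/

/-- `(G^m h)(x) = D^{-m} Σ_{T^m y = x} h(y)`. -/
def GmFun (h : SymX N → ℝ) (m : ℕ) (x : SymX N) : ℝ :=
  ((Dtot p q : ℝ) ^ m)⁻¹ * ((preimTn p q m x).map h).sum

/-- The supremum norm on functions on `J̃`. -/
def supJ (f : ↥(juliaSet p q) → ℝ) : ℝ := ⨆ x, |f x|

section Helpers

variable {p q}


/-- Bloch type theorem: the image of a ball contains a definite ball. -/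
lemma bloch_ball {f : ℂ → ℂ} {z₀ : ℂ} {ρ : ℝ} (hρ : 0 < ρ)
    (hf : DifferentiableOn ℂ f (Metric.ball z₀ ρ)) (hne : deriv f z₀ ≠ 0) :
    ∃ w, Metric.ball w (ρ * ‖deriv f z₀‖ / 200) ⊆ f '' Metric.ball z₀ ρ := by
  have hd : DifferentiableOn ℂ (deriv f) (Metric.ball z₀ ρ) := hf.deriv Metric.isOpen_ball
  have hsub : Metric.closedBall z₀ (ρ/2) ⊆ Metric.ball z₀ ρ :=
    Metric.closedBall_subset_ball (by linarith)
  obtain ⟨a, ha, hmax⟩ := (isCompact_closedBall z₀ (ρ/2)).exists_isMaxOn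
    (f := fun z => ‖deriv f z‖ * (ρ/2 - dist z z₀)) ⟨z₀, by simp; linarith⟩
    ((hd.continuousOn.mono hsub).norm.mul (by fun_prop))
  have h0 : ‖deriv f z₀‖ * (ρ/2) ≤ ‖deriv f a‖ * (ρ/2 - dist a z₀) := by
    have := hmax (show z₀ ∈ Metric.closedBall z₀ (ρ/2) by simp; linarith)
    simpa using this
  have hpos : 0 < ‖deriv f z₀‖ := norm_pos_iff.mpr hne
  have ht0 : 0 < ‖deriv f a‖ * (ρ/2 - dist a z₀) := lt_of_lt_of_le (by positivity) h0
  have hat : 0 < ρ/2 - dist a z₀ := by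
    by_contra h
    push Not at h
    nlinarith [norm_nonneg (deriv f a)]
  have hda : 0 < ‖deriv f a‖ := by
    by_contra h
    push Not at h
    nlinarith [norm_nonneg (deriv f a)]
  set t := (ρ/2 - dist a z₀)/2 with ht
  have htpos : 0 < t := by linarith
  have hbt : Metric.ball a t ⊆ Metric.ball z₀ ρ := by
    apply Metric.ball_subset_ball'; linarith
  have hb2 : ∀ z ∈ Metric.ball a t, ‖deriv f z‖ ≤ 2 * ‖deriv f a‖ := by
    intro z hz
    have h1 : dist z z₀ ≤ dist z a + dist a z₀ := dist_triangle _ _ _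
    rw [Metric.mem_ball] at hz
    have h2 := hmax (show z ∈ Metric.closedBall z₀ (ρ/2) by rw [Metric.mem_closedBall]; linarith)
    simp only at h2
    have h3 : t ≤ ρ/2 - dist z z₀ := by linarith
    have h4 : ‖deriv f z‖ * t ≤ ‖deriv f a‖ * (2 * t) := by
      calc ‖deriv f z‖ * t ≤ ‖deriv f z‖ * (ρ/2 - dist z z₀) := by gcongr
        _ ≤ _ := h2
        _ = _ := by rw [ht]; ring
    nlinarith
  have hsch : ∀ z ∈ Metric.ball a t, ‖deriv f z - deriv f a‖ ≤ 3 * ‖deriv f a‖ / t * dist z a := by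
    intro z hz
    rw [← dist_eq_norm]
    refine Complex.dist_le_div_mul_dist_of_mapsTo_ball (hd.mono hbt) ?_ hz
    intro y hy
    rw [Metric.mem_closedBall, dist_eq_norm]
    linarith [norm_sub_le (deriv f y) (deriv f a), hb2 y hy]
  set s := t / 12 with hs
  have hspos : 0 < s := by positivity
  have hst : Metric.closedBall a s ⊆ Metric.ball a t :=
    Metric.closedBall_subset_ball (by linarith)
  have hlin : ∀ z ∈ Metric.closedBall a s, ‖f z - f a - deriv f a * (z - a)‖ ≤ ‖deriv f a‖ / 4 * ‖z - a‖ := by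
    intro z hz
    have hc : Convex ℝ (Metric.closedBall a s) := convex_closedBall _ _
    have := hc.norm_image_sub_le_of_norm_hasDerivWithin_le (f := fun z => f z - deriv f a * z)
      (f' := fun z => deriv f z - deriv f a) (C := ‖deriv f a‖ / 4) (x := a) (y := z) ?_ ?_
      (by simp; linarith) hz
    · refine le_of_eq_of_le ?_ this
      congr 1
      ring
    · intro x hx
      have hx' := hbt (hst hx)
      have : HasDerivAt f (deriv f x) x :=
        (hf.differentiableAt (Metric.isOpen_ball.mem_nhds hx')).hasDerivAt
      have h2 := (this.sub ((hasDerivAt_id x).const_mul (deriv f a))).hasDerivWithinAt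
        (s := Metric.closedBall a s)
      rw [mul_one] at h2
      exact h2
    · intro x hx
      refine (hsch x (hst hx)).trans ?_
      rw [Metric.mem_closedBall] at hx
      calc 3 * ‖deriv f a‖ / t * dist x a ≤ 3 * ‖deriv f a‖ / t * s := by gcongr
        _ = _ := by rw [hs]; field_simp; norm_num
  have key := DiffContOnCl.ball_subset_image_closedBall (f := f) (z₀ := a) (r := s)
    (ε := 3/4 * ‖deriv f a‖ * s) ?_ hspos ?_ ?_
  · refine ⟨f a, (Metric.ball_subset_ball ?_).trans (key.trans (Set.image_mono (hst.trans hbt)))⟩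
    rw [hs, ht]
    nlinarith
  · refine (DifferentiableOn.diffContOnCl_ball (U := Metric.ball z₀ ρ) hf (hst.trans hbt))
  · intro z hz
    have h1 := hlin z (Metric.sphere_subset_closedBall hz)
    rw [mem_sphere_iff_norm] at hz
    have h2 : ‖deriv f a * (z - a)‖ ≤ ‖f z - f a‖ + ‖f z - f a - deriv f a * (z - a)‖ := by
      have := norm_sub_le (f z - f a) (f z - f a - deriv f a * (z - a))
      simpa using this
    rw [norm_mul, hz] at h2
    rw [hz] at h1
    linarith
  · apply Filter.Eventually.frequently
      (f := 𝓝[≠] a) (p := fun z => f z ≠ f a) ?_ |>.filter_mono nhdsWithin_le_nhds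
    have : Metric.closedBall a s ∈ 𝓝 a := Metric.closedBall_mem_nhds _ hspos
    filter_upwards [mem_nhdsWithin_of_mem_nhds this, self_mem_nhdsWithin] with z hz hza heq
    have h1 := hlin z hz
    have : 0 < ‖z - a‖ := norm_pos_iff.mpr (sub_ne_zero.mpr hza)
    rw [heq] at h1
    simp only [sub_self, zero_sub, norm_neg, norm_mul] at h1
    nlinarith [mul_pos hda this]

/-- holomorphic logarithm on a ball with prescribed value. -/
lemma exists_log_ball {f : ℂ → ℂ} {a : ℂ} {r : ℝ} (hr : 0 < r)
    (hf : DifferentiableOn ℂ f (Metric.ball a r)) (hne : ∀ z ∈ Metric.ball a r, f z ≠ 0) :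
    ∃ g : ℂ → ℂ, DifferentiableOn ℂ g (Metric.ball a r) ∧ g a = Complex.log (f a) ∧
      ∀ z ∈ Metric.ball a r, Complex.exp (g z) = f z := by
  have hd : DifferentiableOn ℂ (deriv f) (Metric.ball a r) := hf.deriv Metric.isOpen_ball
  obtain ⟨g, hga, hg⟩ := (hd.div hf hne).isExactOn_ball.with_val_at a (Complex.log (f a))
  have haB : a ∈ Metric.ball a r := Metric.mem_ball_self hr
  refine ⟨g, fun z hz => (hg z hz).differentiableAt.differentiableWithinAt, hga, ?_⟩
  have hder : ∀ z ∈ Metric.ball a r,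
      HasDerivAt (fun z => Complex.exp (-g z) * f z) 0 z := by
    intro z hz
    have h1 := ((hg z hz).neg.cexp).mul
      (hf.differentiableAt (Metric.isOpen_ball.mem_nhds hz)).hasDerivAt
    have e : Complex.exp ((-g) z) * -(deriv f / f) z * f z + Complex.exp ((-g) z) * deriv f z
        = 0 := by
      have := hne z hz
      rw [Pi.div_apply]
      field_simp
      ring
    rw [e] at h1
    exact h1
  intro z hz
  have hc := (convex_ball a r).is_const_of_fderivWithin_eq_zero (𝕜 := ℂ)
    (f := fun z => Complex.exp (-g z) * f z)
    (fun z hz => (hder z hz).differentiableAt.differentiableWithinAt) (by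
      intro z hz
      rw [fderivWithin_of_isOpen Metric.isOpen_ball hz]
      ext
      simp [(hder z hz).deriv, ]) hz haB
  simp only [hga, Complex.exp_neg, Complex.exp_log (hne a haB)] at hc
  rw [inv_mul_cancel₀ (hne a haB)] at hc
  have := Complex.exp_ne_zero (g z)
  field_simp at hc
  exact hc.symm


lemma norm_log_le {x : ℂ} {B : ℝ} (hB : 0 < B) (h1 : B⁻¹ ≤ ‖x‖) (h2 : ‖x‖ ≤ B) :
    ‖Complex.log x‖ ≤ Real.log B + Real.pi := by
  have hx : 0 < ‖x‖ := lt_of_lt_of_le (by positivity) h1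
  have h3 : |Real.log ‖x‖| ≤ Real.log B := by
    rw [abs_le]
    constructor
    · rw [← Real.log_inv]
      exact Real.log_le_log (by positivity) h1
    · exact Real.log_le_log hx h2
  calc ‖Complex.log x‖ ≤ |(Complex.log x).re| + |(Complex.log x).im| := Complex.norm_le_abs_re_add_abs_im _
    _ ≤ _ := by
      rw [Complex.log_re, Complex.log_im]
      exact add_le_add h3 (Complex.abs_arg_le_pi x)

lemma cosh_two_ge : (3 : ℝ) ≤ Real.cosh 2 := by
  rw [Real.cosh_eq]
  have h1 : (2.7 : ℝ) < Real.exp 1 := lt_trans (by norm_num) Real.exp_one_gt_d9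
  have h2 : Real.exp 2 = Real.exp 1 * Real.exp 1 := by rw [← Real.exp_add]; norm_num
  have := Real.exp_pos (-2)
  nlinarith

lemma cosh_dense_pos (w : ℂ) (hw : 0 ≤ w.re) :
    ∃ w' : ℂ, dist w' w < 6 ∧ ∃ n : ℤ, Complex.cosh w' = 2 * n + 1 := by
  set x := w.re
  have hlen : Real.cosh x + 2 ≤ Real.cosh (x + 2) := by
    rw [Real.cosh_add]
    have := Real.one_le_cosh x
    have h2 : 0 ≤ Real.sinh x * Real.sinh 2 :=
      mul_nonneg (Real.sinh_nonneg_iff.mpr hw) (Real.sinh_nonneg_iff.mpr (by norm_num))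
    nlinarith [cosh_two_ge]
  set n : ℤ := ⌈(Real.cosh x - 1) / 2⌉ with hn
  have hn1 : Real.cosh x ≤ 2 * n + 1 := by
    have := Int.le_ceil ((Real.cosh x - 1) / 2)
    rw [← hn] at this
    linarith
  have hn2 : (2 * n + 1 : ℝ) ≤ Real.cosh (x + 2) := by
    have := Int.ceil_lt_add_one ((Real.cosh x - 1) / 2)
    rw [← hn] at this
    linarith
  obtain ⟨x', hx', hcx⟩ := intermediate_value_Icc (show x ≤ x + 2 by linarith)
    (Real.continuous_cosh.continuousOn) ⟨hn1, hn2⟩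
  set k : ℤ := round (w.im / Real.pi) with hk
  have hk1 : |w.im - k * Real.pi| ≤ Real.pi / 2 := by
    have := abs_sub_round (w.im / Real.pi)
    rw [← hk] at this
    have e : w.im - k * Real.pi = (w.im / Real.pi - k) * Real.pi := by
      field_simp
    rw [e, abs_mul, abs_of_pos Real.pi_pos]
    nlinarith [Real.pi_pos]
  refine ⟨x' + (k * Real.pi : ℝ) * Complex.I, ?_, ?_⟩
  · rw [dist_eq_norm]
    refine (Complex.norm_le_abs_re_add_abs_im _).trans_lt ?_
    have hpi : Real.pi < 4 := Real.pi_lt_four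
    have e1 : ((x' + (k * Real.pi : ℝ) * Complex.I : ℂ) - w).re = x' - x := by simp [x]
    have e2 : ((x' + (k * Real.pi : ℝ) * Complex.I : ℂ) - w).im = -(w.im - k * Real.pi) := by simp
    rw [e1, e2, abs_neg, abs_of_nonneg (by linarith [hx'.1])]
    linarith [hx'.2]
  · rw [Complex.cosh_add, Complex.cosh_mul_I, Complex.sinh_mul_I, ← Complex.ofReal_cos,
      ← Complex.ofReal_sin, Real.sin_int_mul_pi, ← Complex.ofReal_cosh, hcx]
    rcases Int.even_or_odd k with h | h
    · refine ⟨n, ?_⟩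
      rw [Real.cos_int_mul_pi, h.neg_one_zpow]
      push_cast; ring
    · refine ⟨-n - 1, ?_⟩
      rw [Real.cos_int_mul_pi, h.neg_one_zpow]
      push_cast; ring

lemma cosh_dense (w : ℂ) :
    ∃ w' : ℂ, dist w' w < 6 ∧ ∃ n : ℤ, Complex.cosh w' = 2 * n + 1 := by
  rcases le_total 0 w.re with h | h
  · exact cosh_dense_pos w h
  · obtain ⟨w', h1, n, h2⟩ := cosh_dense_pos (-w) (by simpa using h)
    refine ⟨-w', ?_, n, by rw [Complex.cosh_neg, h2]⟩
    rwa [← dist_neg_neg, neg_neg]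

lemma lift_cosh {f : ℂ → ℂ} {a : ℂ} {r m : ℝ} (hr : 0 < r) (hm : 1 ≤ m)
    (hf : DifferentiableOn ℂ f (Metric.ball a r)) (h0 : ∀ z ∈ Metric.ball a r, f z ≠ 0)
    (h1 : ∀ z ∈ Metric.ball a r, f z ≠ 1) (ha1 : m⁻¹ ≤ ‖f a‖) (ha2 : ‖f a‖ ≤ m) :
    ∃ h : ℂ → ℂ, DifferentiableOn ℂ h (Metric.ball a r) ∧
      ‖h a‖ ≤ Real.log (2 * (Real.log m + 4) + 1) + Real.pi ∧
      ∀ z ∈ Metric.ball a r, f z = - Complex.exp (Real.pi * Complex.I * Complex.cosh (h z)) := by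
  have haB : a ∈ Metric.ball a r := Metric.mem_ball_self hr
  have hpi : (Real.pi : ℂ) * Complex.I ≠ 0 := by simp [Real.pi_ne_zero]
  obtain ⟨l, hl, hla, hle⟩ := exists_log_ball (f := fun z => - f z) hr hf.neg
    (fun z hz => neg_ne_zero.mpr (h0 z hz))
  set W : ℂ → ℂ := fun z => l z / (Real.pi * Complex.I) with hW
  have hWd : DifferentiableOn ℂ W (Metric.ball a r) := hl.div_const _
  have hWe : ∀ z ∈ Metric.ball a r, Complex.exp (Real.pi * Complex.I * W z) = - f z := by
    intro z hz
    rw [← hle z hz, hW]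
    congr 1
    field_simp
  have hWodd : ∀ z ∈ Metric.ball a r, W z ^ 2 - 1 ≠ 0 := by
    intro z hz h
    apply h1 z hz
    have h2 : (W z - 1) * (W z + 1) = 0 := by linear_combination h
    have := hWe z hz
    rcases mul_eq_zero.mp h2 with h3 | h3
    · rw [sub_eq_zero.mp h3, mul_one, Complex.exp_pi_mul_I] at this
      exact (neg_injective this).symm
    · rw [eq_neg_of_add_eq_zero_left h3, mul_neg, mul_one, Complex.exp_neg, Complex.exp_pi_mul_I] at this
      rw [← neg_injective (a₁ := f z) (a₂ := 1)]
      rw [← this]; norm_num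
  obtain ⟨g, hg, -, hge⟩ := exists_log_ball (f := fun z => W z ^ 2 - 1) hr
    ((hWd.pow 2).sub_const 1) hWodd
  set s : ℂ → ℂ := fun z => Complex.exp (g z / 2) with hs
  have hsd : DifferentiableOn ℂ s (Metric.ball a r) := (hg.div_const 2).cexp
  have hs2 : ∀ z ∈ Metric.ball a r, s z ^ 2 = W z ^ 2 - 1 := by
    intro z hz
    rw [← hge z hz, hs]
    simp only
    rw [← Complex.exp_nat_mul]
    congr 1
    push_cast; ring
  have hprod : ∀ z ∈ Metric.ball a r, (W z + s z) * (W z - s z) = 1 := by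
    intro z hz
    linear_combination - hs2 z hz
  have hne : ∀ z ∈ Metric.ball a r, W z + s z ≠ 0 := by
    intro z hz h
    have := hprod z hz
    rw [h, zero_mul] at this
    exact zero_ne_one this
  obtain ⟨h, hh, hha, hhe⟩ := exists_log_ball (f := fun z => W z + s z) hr (hWd.add hsd) hne
  refine ⟨h, hh, ?_, ?_⟩
  · have hlogm : 0 ≤ Real.log m := Real.log_nonneg hm
    have hA : ‖W a‖ ≤ Real.log m + 4 := by
      rw [hW]
      simp only [norm_div, norm_mul, Complex.norm_I, mul_one]
      have := norm_log_le (x := - f a) (B := m) (by linarith) (by rwa [norm_neg]) (by rwa [norm_neg])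
      rw [hla, Complex.norm_real, Real.norm_of_nonneg Real.pi_pos.le, div_le_iff₀ Real.pi_pos]
      nlinarith [Real.pi_gt_three]
    set A := Real.log m + 4 with hAd
    have hsA : ‖s a‖ ≤ A + 1 := by
      have e := hs2 a haB
      have : ‖s a‖ ^ 2 ≤ ‖W a‖ ^ 2 + 1 := by
        rw [← norm_pow, e]
        refine (norm_sub_le _ _).trans ?_
        simp
      nlinarith [norm_nonneg (s a), norm_nonneg (W a)]
    have hX : ‖W a + s a‖ ≤ 2 * A + 1 := (norm_add_le _ _).trans (by linarith)
    have hY : ‖W a - s a‖ ≤ 2 * A + 1 := (norm_sub_le _ _).trans (by linarith)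
    rw [hha]
    refine norm_log_le (by linarith) ?_ hX
    have e := congrArg norm (hprod a haB)
    rw [norm_mul, norm_one] at e
    rw [inv_le_iff_one_le_mul₀ (by linarith)]
    nlinarith [norm_nonneg (W a + s a)]
  · intro z hz
    have e : Complex.cosh (h z) = W z := by
      rw [Complex.cosh, Complex.exp_neg, hhe z hz]
      have : (W z + s z)⁻¹ = W z - s z := by
        rw [inv_eq_iff_eq_inv]
        exact eq_inv_of_mul_eq_one_left (hprod z hz)
      rw [this]
      ring
    rw [e, hWe z hz, neg_neg]

lemma lift_deriv_bound {f h : ℂ → ℂ} {a : ℂ} {r : ℝ} (hr : 0 < r)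
    (h1 : ∀ z ∈ Metric.ball a r, f z ≠ 1) (hh : DifferentiableOn ℂ h (Metric.ball a r))
    (he : ∀ z ∈ Metric.ball a r, f z = - Complex.exp (Real.pi * Complex.I * Complex.cosh (h z)))
    {z : ℂ} (hz : z ∈ Metric.ball a (r / 2)) : ‖deriv h z‖ ≤ 2400 / r := by
  by_contra hcon
  push Not at hcon
  have hsub : Metric.ball z (r/2) ⊆ Metric.ball a r := by
    apply Metric.ball_subset_ball'
    rw [Metric.mem_ball] at hz
    linarith
  have hpos : 0 < ‖deriv h z‖ := lt_trans (by positivity) hcon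
  obtain ⟨w, hw⟩ := bloch_ball (show 0 < r / 2 by linarith) (hh.mono hsub)
    (norm_pos_iff.mp hpos)
  obtain ⟨w', hw', n, hn⟩ := cosh_dense w
  have : w' ∈ Metric.ball w (r / 2 * ‖deriv h z‖ / 200) := by
    rw [Metric.mem_ball]
    rw [div_lt_iff₀ hr] at hcon
    linarith
  obtain ⟨y, hy, rfl⟩ := hw this
  apply h1 y (hsub hy)
  rw [he y (hsub hy), hn]
  have : (Real.pi : ℂ) * Complex.I * (2 * n + 1) = Real.pi * Complex.I + n * (2 * Real.pi * Complex.I) := by ring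
  rw [this, Complex.exp_periodic.int_mul n, Complex.exp_pi_mul_I, neg_neg]

lemma schottky_unif {m r η : ℝ} (hm : 1 ≤ m) (hr : 0 < r) (hη : 0 < η) :
    ∃ δ > 0, ∀ (a : ℂ) (f : ℂ → ℂ), DifferentiableOn ℂ f (Metric.ball a r) →
      (∀ z ∈ Metric.ball a r, f z ≠ 0) → (∀ z ∈ Metric.ball a r, f z ≠ 1) →
      m⁻¹ ≤ ‖f a‖ → ‖f a‖ ≤ m → ∀ z, dist z a < δ → dist (f z) (f a) < η := by
  set M := Real.log (2 * (Real.log m + 4) + 1) + Real.pi with hM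
  have huc : UniformContinuousOn (fun w => - Complex.exp (Real.pi * Complex.I * Complex.cosh w))
      (Metric.closedBall 0 (M + 1)) := by
    apply (isCompact_closedBall _ _).uniformContinuousOn_of_continuous
    apply Continuous.continuousOn
    have := Complex.continuous_cosh
    fun_prop
  rw [Metric.uniformContinuousOn_iff] at huc
  obtain ⟨δ₁, hδ₁, hu⟩ := huc η hη
  refine ⟨min (r / 2) (r / 2400 * min 1 δ₁), by positivity, ?_⟩
  intro a f hf h0 h1 ha1 ha2 z hz
  obtain ⟨h, hh, hha, he⟩ := lift_cosh hr hm hf h0 h1 ha1 ha2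
  have hz1 : z ∈ Metric.ball a (r / 2) := lt_of_lt_of_le hz (min_le_left _ _)
  have hsub : Metric.ball a (r/2) ⊆ Metric.ball a r := Metric.ball_subset_ball (by linarith)
  have haB : a ∈ Metric.ball a (r / 2) := Metric.mem_ball_self (by linarith)
  have hlip : ‖h z - h a‖ ≤ 2400 / r * ‖z - a‖ := by
    refine (convex_ball a (r/2)).norm_image_sub_le_of_norm_deriv_le (𝕜 := ℂ) ?_ ?_ haB hz1
    · intro x hx
      exact hh.differentiableAt (Metric.isOpen_ball.mem_nhds (hsub hx))
    · intro x hx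
      exact lift_deriv_bound hr h1 hh he hx
  have hlt : ‖h z - h a‖ < min 1 δ₁ := by
    refine hlip.trans_lt ?_
    have h2 : dist z a < r / 2400 * min 1 δ₁ := lt_of_lt_of_le hz (min_le_right _ _)
    rw [dist_eq_norm] at h2
    calc 2400 / r * ‖z - a‖ < 2400 / r * (r / 2400 * min 1 δ₁) := by gcongr
      _ = _ := by field_simp
  rw [he z (hsub hz1), he a (hsub haB)]
  apply hu
  · rw [mem_closedBall_zero_iff]
    have := norm_le_norm_add_norm_sub' (h z) (h a)
    linarith [hlt.trans_le (min_le_left _ _)]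
  · rw [mem_closedBall_zero_iff]
    linarith
  · rw [dist_eq_norm]
    exact hlt.trans_le (min_le_right _ _)

/-- Montel's theorem (equicontinuity form), for maps into a metric compactification. -/
lemma montel_equi {Y : Type*} [PseudoMetricSpace Y] (c : ℂ → Y) (hc : Continuous c) (yinf : Y)
    (hinf : Tendsto c (cocompact ℂ) (𝓝 yinf)) {r ε : ℝ} (hr : 0 < r) (hε : 0 < ε) :
    ∃ δ > 0, ∀ (a : ℂ) (f : ℂ → ℂ), DifferentiableOn ℂ f (Metric.ball a r) →
      (∀ z ∈ Metric.ball a r, f z ≠ 0) → (∀ z ∈ Metric.ball a r, f z ≠ 1) →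
      ∀ z, dist z a < δ → dist (c (f z)) (c (f a)) < ε := by
  obtain ⟨ρ, hρ, hc0⟩ := Metric.continuousAt_iff.mp (hc.continuousAt (x := 0)) (ε/2) (by linarith)
  have h2 : ∀ᶠ y in cocompact ℂ, dist (c y) yinf < ε / 2 :=
    hinf (Metric.ball_mem_nhds _ (by linarith))
  rw [← Metric.cobounded_eq_cocompact, ← comap_norm_atTop, eventually_comap] at h2
  obtain ⟨B, hB⟩ := eventually_atTop.mp h2
  set m := max (max 1 B) ρ⁻¹ with hmd
  have hm1 : 1 ≤ m := (le_max_left _ _).trans (le_max_left _ _)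
  have hmB : B ≤ m := (le_max_right _ _).trans (le_max_left _ _)
  have hmρ : m⁻¹ ≤ ρ := inv_le_of_inv_le₀ hρ (le_max_right _ _)
  have huc : UniformContinuousOn c (Metric.closedBall 0 (m + 1)) :=
    (isCompact_closedBall _ _).uniformContinuousOn_of_continuous hc.continuousOn
  rw [Metric.uniformContinuousOn_iff] at huc
  obtain ⟨η, hη, hu⟩ := huc (ε / 2) (by linarith)
  obtain ⟨δ, hδ, hs⟩ := schottky_unif hm1 (show 0 < r / 2 by linarith) (show 0 < min 1 η by positivity)
  refine ⟨min δ (r/2), by positivity, ?_⟩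
  intro a f hf h0 h1 z hz
  have hza : dist z a < δ := hz.trans_le (min_le_left _ _)
  have hzr : dist z a < r / 2 := hz.trans_le (min_le_right _ _)
  have hseg : ∀ a' ∈ segment ℝ a z, dist a' a ≤ dist z a ∧ dist a' z ≤ dist z a := by
    intro a' ha'
    have := dist_add_dist_of_mem_segment ha'
    rw [dist_comm a a', dist_comm a z] at this
    constructor <;> linarith [dist_nonneg (x := a') (y := a), dist_nonneg (x := a') (y := z)]
  have hsegB : segment ℝ a z ⊆ Metric.ball a r := by
    intro a' ha'
    rw [Metric.mem_ball]
    linarith [(hseg a' ha').1]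
  by_cases hex : ∃ a' ∈ segment ℝ a z, m⁻¹ ≤ ‖f a'‖ ∧ ‖f a'‖ ≤ m
  · obtain ⟨a', ha', hl, hu'⟩ := hex
    have hsub : Metric.ball a' (r/2) ⊆ Metric.ball a r := by
      apply Metric.ball_subset_ball'
      linarith [(hseg a' ha').1]
    have key := hs a' f (hf.mono hsub) (fun z hz => h0 z (hsub hz)) (fun z hz => h1 z (hsub hz)) hl hu'
    have key2 : ∀ y, dist y a' < δ → dist (c (f y)) (c (f a')) < ε / 2 := by
      intro y hy
      have := key y hy
      apply hu
      · rw [mem_closedBall_zero_iff]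
        rw [dist_eq_norm] at this
        have h3 := norm_le_norm_add_norm_sub' (f y) (f a')
        linarith [this.trans_le (min_le_left _ _)]
      · rw [mem_closedBall_zero_iff]
        linarith
      · exact this.trans_le (min_le_right _ _)
    have k1 := key2 z (by rw [dist_comm]; linarith [(hseg a' ha').2])
    have k2 := key2 a (by rw [dist_comm]; linarith [(hseg a' ha').1])
    rw [dist_comm] at k2
    linarith [dist_triangle (c (f z)) (c (f a')) (c (f a))]
  · push Not at hex
    have hpre : IsPreconnected ((fun y => ‖f y‖) '' segment ℝ a z) :=
      (convex_segment a z).isPreconnected.image _ ((hf.continuousOn.mono hsegB).norm)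
    have hoc := hpre.ordConnected
    have hmm : m⁻¹ ≤ m := (inv_le_one_of_one_le₀ hm1).trans hm1
    have hno : m⁻¹ ∉ (fun y => ‖f y‖) '' segment ℝ a z := by
      rintro ⟨y, hy, hym⟩
      simp only at hym
      have := hex y hy hym.ge
      rw [hym] at this
      linarith
    have hA := left_mem_segment ℝ a z
    have hZ := right_mem_segment ℝ a z
    have hsame : ¬ ((‖f a‖ < m⁻¹ ∧ m⁻¹ ≤ ‖f z‖) ∨ (‖f z‖ < m⁻¹ ∧ m⁻¹ ≤ ‖f a‖)) := by
      rintro (⟨h3, h4⟩ | ⟨h3, h4⟩)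
      · exact hno (hoc.out ⟨a, hA, rfl⟩ ⟨z, hZ, rfl⟩ ⟨h3.le, h4⟩)
      · exact hno (hoc.out ⟨z, hZ, rfl⟩ ⟨a, hA, rfl⟩ ⟨h3.le, h4⟩)
    by_cases hca : ‖f a‖ < m⁻¹
    · have hcz : ‖f z‖ < m⁻¹ := by
        by_contra h
        exact hsame (Or.inl ⟨hca, not_lt.mp h⟩)
      have k1 := hc0 (x := f a) (by rw [dist_zero_right]; linarith)
      have k2 := hc0 (x := f z) (by rw [dist_zero_right]; linarith)
      rw [dist_comm] at k1
      linarith [dist_triangle (c (f z)) (c 0) (c (f a))]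
    · have hcz : ¬ ‖f z‖ < m⁻¹ := by
        intro h
        exact hsame (Or.inr ⟨h, not_lt.mp hca⟩)
      have k1 := hB _ (hmB.trans (hex a hA (not_lt.mp hca)).le) (f a) rfl
      have k2 := hB _ (hmB.trans (hex z hZ (not_lt.mp hcz)).le) (f z) rfl
      rw [dist_comm] at k1
      linarith [dist_triangle (c (f z)) yinf (c (f a))]


/-! ### Sphere -/
def emb : Sphere → WithLp 2 (ℂ × ℝ) := fun z =>
  OnePoint.elim z (WithLp.toLp 2 (0, 1))
    (fun a => WithLp.toLp 2 ((2 * (1 + ‖a‖ ^ 2)⁻¹ : ℝ) • a, (1 - 2 * (1 + ‖a‖ ^ 2)⁻¹ : ℝ)))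

lemma emb_coe (a : ℂ) : emb (a : Sphere) =
    WithLp.toLp 2 ((2 * (1 + ‖a‖ ^ 2)⁻¹ : ℝ) • a, (1 - 2 * (1 + ‖a‖ ^ 2)⁻¹ : ℝ)) := rfl
lemma emb_infty : emb (∞ : Sphere) = WithLp.toLp 2 (0, 1) := rfl

lemma tfst (a : ℂ) (b : ℝ) : (WithLp.toLp 2 (a, b)).fst = a := rfl
lemma tsnd (a : ℂ) (b : ℝ) : (WithLp.toLp 2 (a, b)).snd = b := rfl

lemma sphDist_eq (z w : Sphere) : sphDist z w = dist (emb z) (emb w) := by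
  rw [WithLp.prod_dist_eq_of_L2]
  have key : ∀ a : ℂ, Real.sqrt (1 + ‖a‖^2) ^ 2 = 1 + ‖a‖^2 := fun a => Real.sq_sqrt (by positivity)
  have hn : ∀ a : ℂ, ‖a‖^2 = a.re^2 + a.im^2 := fun a => by
    rw [← Complex.normSq_eq_norm_sq, Complex.normSq_apply]; ring
  symm
  induction z using OnePoint.rec with
  | infty =>
    induction w using OnePoint.rec with
    | infty => simp [sphDist]
    | coe b =>
      rw [Real.sqrt_eq_iff_mul_self_eq (by positivity) (by simp [sphDist]; positivity)]
      simp only [sphDist, OnePoint.elim_infty, OnePoint.elim_some, emb_coe, emb_infty, tfst, tsnd,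
        Complex.dist_eq, Real.dist_eq, sq_abs, zero_sub, norm_neg]
      rw [hn ((2 * (1 + ‖b‖ ^ 2)⁻¹ : ℝ) • b)]
      rw [← sq, div_pow, key]
      have h2 : 1 + ‖b‖^2 ≠ 0 := by positivity
      simp only [Complex.real_smul, Complex.re_ofReal_mul, Complex.im_ofReal_mul]
      have := hn b
      rw [hn b] at *
      field_simp
      ring
  | coe a =>
    induction w using OnePoint.rec with
    | infty =>
      rw [Real.sqrt_eq_iff_mul_self_eq (by positivity) (by simp [sphDist]; positivity)]
      simp only [sphDist, OnePoint.elim_infty, OnePoint.elim_some, emb_coe, emb_infty, tfst, tsnd,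
        Complex.dist_eq, Real.dist_eq, sq_abs, sub_zero]
      rw [hn ((2 * (1 + ‖a‖ ^ 2)⁻¹ : ℝ) • a)]
      rw [← sq, div_pow, key]
      have h2 : 1 + ‖a‖^2 ≠ 0 := by positivity
      simp only [Complex.real_smul, Complex.re_ofReal_mul, Complex.im_ofReal_mul]
      rw [hn a] at *
      field_simp
      ring
    | coe b =>
      rw [Real.sqrt_eq_iff_mul_self_eq (by positivity) (by simp [sphDist]; positivity)]
      simp only [sphDist, OnePoint.elim_infty, OnePoint.elim_some, emb_coe, emb_infty, tfst, tsnd,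
        Complex.dist_eq, Real.dist_eq, sq_abs]
      rw [hn ((2 * (1 + ‖a‖ ^ 2)⁻¹ : ℝ) • a - (2 * (1 + ‖b‖ ^ 2)⁻¹ : ℝ) • b)]
      rw [← sq, div_pow, mul_pow, mul_pow, key, key, hn (a - b)]
      have h2 : 1 + ‖a‖^2 ≠ 0 := by positivity
      have h3 : 1 + ‖b‖^2 ≠ 0 := by positivity
      simp only [Complex.real_smul, Complex.re_ofReal_mul, Complex.im_ofReal_mul, Complex.sub_re,
        Complex.sub_im]
      rw [hn a, hn b] at *
      field_simp
      ring

lemma emb_cont : Continuous emb := by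
  rw [OnePoint.continuous_iff]
  constructor
  · rw [Filter.coclosedCompact_eq_cocompact]
    have h1 : Tendsto (fun a : ℂ => ‖a‖) (cocompact ℂ) atTop := tendsto_norm_cocompact_atTop
    have h2 : Tendsto (fun a : ℂ => (1 + ‖a‖^2)⁻¹) (cocompact ℂ) (𝓝 0) :=
      tendsto_inv_atTop_zero.comp (tendsto_atTop_add_const_left _ _ ((tendsto_pow_atTop two_ne_zero).comp h1))
    have h3 : Tendsto (fun a : ℂ => (2 * (1 + ‖a‖ ^ 2)⁻¹ : ℝ) • a) (cocompact ℂ) (𝓝 0) := by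
      have h4 : Tendsto (fun a : ℂ => 2 * ‖a‖⁻¹) (cocompact ℂ) (𝓝 0) := by
        simpa using (tendsto_inv_atTop_zero.comp h1).const_mul 2
      refine squeeze_zero_norm (fun a => ?_) h4
      rw [norm_smul, Real.norm_of_nonneg (by positivity)]
      rcases eq_or_ne a 0 with rfl | ha
      · simp
      · have : 0 < ‖a‖ := norm_pos_iff.2 ha
        rw [mul_assoc]
        gcongr
        rw [← div_eq_inv_mul, ← one_div, div_le_div_iff₀ (by positivity) this]
        nlinarith
    have h5 : Tendsto (fun a : ℂ => ((2 * (1 + ‖a‖ ^ 2)⁻¹ : ℝ) • a, (1 - 2 * (1 + ‖a‖ ^ 2)⁻¹ : ℝ)))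
      (cocompact ℂ) (𝓝 ((0:ℂ), (1:ℝ))) := by
      refine h3.prodMk_nhds ?_
      simpa using (h2.const_mul 2).const_sub 1
    exact ((WithLp.prod_continuous_toLp 2 ℂ ℝ).tendsto _).comp h5
  · have : Continuous (fun a : ℂ => ((2 * (1 + ‖a‖ ^ 2)⁻¹ : ℝ) • a, (1 - 2 * (1 + ‖a‖ ^ 2)⁻¹ : ℝ))) := by
      have h : ∀ a : ℂ, 1 + ‖a‖^2 ≠ 0 := fun a => by positivity
      fun_prop (disch := exact h _)
    exact (WithLp.prod_continuous_toLp 2 ℂ ℝ).comp this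

lemma emb_inj : Function.Injective emb := by
  intro z w h
  have h0 : sphDist z w = 0 := by rw [sphDist_eq, h, dist_self]
  induction z using OnePoint.rec with
  | infty =>
    induction w using OnePoint.rec with
    | infty => rfl
    | coe b =>
      exfalso
      have : 0 < sphDist (∞ : Sphere) (b : Sphere) := by simp [sphDist]; positivity
      linarith
  | coe a =>
    induction w using OnePoint.rec with
    | infty =>
      exfalso
      have : 0 < sphDist (a : Sphere) (∞ : Sphere) := by simp [sphDist]; positivity
      linarith
    | coe b =>
      have h1 : Real.sqrt (1 + ‖a‖^2) ≠ 0 := by positivity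
      have h2 : Real.sqrt (1 + ‖b‖^2) ≠ 0 := by positivity
      simp [sphDist, h1, h2] at h0
      rw [h0]

lemma emb_emb : IsEmbedding emb := (emb_cont.isClosedEmbedding emb_inj).isEmbedding

@[reducible] def sphMetric : MetricSpace Sphere := emb_emb.comapMetricSpace emb

lemma sphMetric_dist (z w : Sphere) : (sphMetric.dist z w) = sphDist z w := (sphDist_eq z w).symm

/-! ### Homogeneous coordinates -/
def pr (s : ℂ × ℂ) : Sphere := if s.2 = 0 then (∞ : Sphere) else ((s.1 / s.2 : ℂ) : Sphere)

lemma pr_contAt {s : ℂ × ℂ} (hs : s ≠ 0) : ContinuousAt pr s := by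
  by_cases h : s.2 = 0
  · have h1 : s.1 ≠ 0 := fun h1 => hs (Prod.ext h1 h)
    rw [ContinuousAt, show pr s = (∞ : Sphere) by simp [pr, h], (OnePoint.hasBasis_nhds_infty (X := ℂ)).tendsto_right_iff]
    rintro K ⟨hKc, hK⟩
    obtain ⟨M, hM⟩ := hK.isBounded.exists_norm_le
    have h2 : ∀ᶠ t : ℂ × ℂ in 𝓝 s, (|M| + 1) * ‖t.2‖ < ‖t.1‖ := by
      apply IsOpen.mem_nhds (isOpen_lt (by fun_prop) (by fun_prop))
      simp [h, h1]
    filter_upwards [h2] with t ht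
    by_cases h3 : t.2 = 0
    · simp [pr, h3]
    · left
      refine ⟨t.1 / t.2, fun hmem => ?_, by simp [pr, h3]⟩
      have := hM _ hmem
      rw [norm_div, div_le_iff₀ (norm_pos_iff.2 h3)] at this
      nlinarith [le_abs_self M, norm_nonneg t.2]
  · have : (fun t : ℂ × ℂ => ((t.1 / t.2 : ℂ) : Sphere)) =ᶠ[𝓝 s] pr := by
      have : ∀ᶠ t : ℂ × ℂ in 𝓝 s, t.2 ≠ 0 := continuousAt_snd.eventually_ne h
      filter_upwards [this] with t ht
      simp [pr, ht]
    refine ContinuousAt.congr ?_ this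
    exact OnePoint.continuous_coe.continuousAt.comp (continuousAt_fst.div continuousAt_snd h)

lemma pr_smul {c : ℂ} (hc : c ≠ 0) (s : ℂ × ℂ) : pr (c * s.1, c * s.2) = pr s := by
  simp only [pr, mul_eq_zero, hc, false_or]
  rw [mul_div_mul_left _ _ hc]

lemma pr_coe (z : ℂ) : pr (z, 1) = (z : Sphere) := by simp [pr]

abbrev S3 := Metric.sphere (0 : ℂ × ℂ) 1

lemma S3_ne (s : S3) : (s : ℂ × ℂ) ≠ 0 := by
  have := s.2
  intro h
  rw [h] at this; simp at this

lemma pr_exists (z : Sphere) : ∃ s : S3, pr s = z := by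
  have h : ∃ s : ℂ × ℂ, s ≠ 0 ∧ pr s = z := by
    induction z using OnePoint.rec with
    | infty => exact ⟨(1, 0), by simp, by simp [pr]⟩
    | coe a => exact ⟨(a, 1), by simp, by simp [pr]⟩
  obtain ⟨s, hs, rfl⟩ := h
  have hn : ‖s‖ ≠ 0 := norm_ne_zero_iff.2 hs
  refine ⟨⟨((‖s‖⁻¹ : ℝ) : ℂ) • s, ?_⟩, ?_⟩
  · rw [mem_sphere_zero_iff_norm, norm_smul]
    simp [hn]
  · exact pr_smul (by simp [hn]) s

lemma pr_cont : Continuous (fun s : S3 => pr s) :=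
  continuous_iff_continuousAt.2 fun s => (pr_contAt (S3_ne s)).comp continuous_subtype_val.continuousAt

lemma pr_quot : IsQuotientMap (fun s : S3 => pr s) :=
  pr_cont.isClosedMap.isQuotientMap pr_cont pr_exists


/-! ### Fibers -/
def homE (d : ℕ) (P : ℂ[X]) (s : ℂ × ℂ) : ℂ :=
  ∑ k ∈ Finset.range (d + 1), P.coeff k * s.1 ^ k * s.2 ^ (d - k)

lemma homE_of_ne {d : ℕ} {P : ℂ[X]} (hP : P.natDegree ≤ d) {s : ℂ × ℂ} (hs : s.2 ≠ 0) :
    homE d P s = s.2 ^ d * P.eval (s.1 / s.2) := by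
  rw [homE, eval_eq_sum_range' (Nat.lt_succ_of_le hP), Finset.mul_sum]
  refine Finset.sum_congr rfl fun k hk => ?_
  have hk' : k ≤ d := Nat.lt_succ_iff.1 (Finset.mem_range.1 hk)
  have : s.2 ^ d = s.2 ^ (d - k) * s.2 ^ k := by rw [← pow_add]; congr 1; omega
  rw [this, div_pow]
  field_simp

lemma homE_of_eq {d : ℕ} {P : ℂ[X]} {s : ℂ × ℂ} (hs : s.2 = 0) :
    homE d P s = P.coeff d * s.1 ^ d := by
  rw [homE, Finset.sum_eq_single d]
  · simp
  · intro k hk hkd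
    have hk' : k < d + 1 := (Finset.mem_range.1 hk)
    have : d - k ≠ 0 := by omega
    simp [hs, this]
  · intro h; simp at h

lemma coprime_eval {P Q : ℂ[X]} (h : IsCoprime P Q) (z : ℂ) : ¬ (P.eval z = 0 ∧ Q.eval z = 0) := by
  rintro ⟨h1, h2⟩
  obtain ⟨a, b, hab⟩ := h
  have := congrArg (Polynomial.eval z) hab
  simp [h1, h2] at this

lemma coprime_coeff {P Q : ℂ[X]} (hd : 1 ≤ max P.natDegree Q.natDegree) :
    ¬ (P.coeff (max P.natDegree Q.natDegree) = 0 ∧ Q.coeff (max P.natDegree Q.natDegree) = 0) := by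
  rintro ⟨h1, h2⟩
  rcases le_total P.natDegree Q.natDegree with h | h
  · rw [max_eq_right h] at *
    have : Q = 0 := by rwa [coeff_natDegree, leadingCoeff_eq_zero] at h2
    simp [this] at hd
  · rw [max_eq_left h] at *
    have : P = 0 := by rwa [coeff_natDegree, leadingCoeff_eq_zero] at h1
    simp [this] at hd

lemma ratEval_pr {P Q : ℂ[X]} (h : IsCoprime P Q) (hd : 1 ≤ max P.natDegree Q.natDegree)
    {s : ℂ × ℂ} (hs : s ≠ 0) :
    (homE (max P.natDegree Q.natDegree) P s, homE (max P.natDegree Q.natDegree) Q s) ≠ 0 ∧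
    ratEval P Q (pr s) =
      pr (homE (max P.natDegree Q.natDegree) P s, homE (max P.natDegree Q.natDegree) Q s) := by
  by_cases h2 : s.2 = 0
  · have h1 : s.1 ≠ 0 := fun h1 => hs (Prod.ext h1 h2)
    rw [homE_of_eq h2, homE_of_eq h2]
    have hc := coprime_coeff hd
    have e : pr s = (∞ : Sphere) := by simp [pr, h2]
    constructor
    · simpa [Prod.ext_iff, h1] using hc
    · rw [e, ratEval, OnePoint.elim_infty]
      rcases lt_trichotomy P.natDegree Q.natDegree with hl | hl | hl
      · rw [if_neg (by omega), if_pos hl, max_eq_right hl.le, coeff_eq_zero_of_natDegree_lt hl]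
        have : Q ≠ 0 := by rintro rfl; simp at hl
        simp [pr, this, h1]
      · rw [if_neg (by omega), if_neg (by omega), hl, max_self]
        have : Q ≠ 0 := by rintro rfl; simp [hl] at hd
        have e2 : P.coeff Q.natDegree = P.leadingCoeff := by rw [← hl]; rfl
        simp only [pr, coeff_natDegree, e2]
        rw [if_neg (by simp [this, h1]), mul_div_mul_right _ _ (pow_ne_zero _ h1)]
      · rw [if_pos hl, max_eq_left hl.le, coeff_eq_zero_of_natDegree_lt hl]
        simp [pr]
  · rw [homE_of_ne (le_max_left _ _) h2, homE_of_ne (le_max_right _ _) h2]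
    have e : pr s = ((s.1 / s.2 : ℂ) : Sphere) := by simp [pr, h2]
    constructor
    · simpa [Prod.ext_iff, h2] using coprime_eval h (s.1 / s.2)
    · rw [pr_smul (s := (_, _)) (pow_ne_zero _ h2), e, ratEval, OnePoint.elim_some]
      simp [pr]

lemma homE_cont (d : ℕ) (P : ℂ[X]) : Continuous (homE d P) := by
  unfold homE; fun_prop

lemma ratEval_cont {P Q : ℂ[X]} (h : IsCoprime P Q) (hd : 1 ≤ max P.natDegree Q.natDegree) :
    Continuous (ratEval P Q) := by
  rw [pr_quot.continuous_iff, continuous_iff_continuousAt]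
  intro s
  have e : ratEval P Q ∘ (fun s : S3 => pr s) = fun s : S3 => pr (homE (max P.natDegree Q.natDegree) P s, homE (max P.natDegree Q.natDegree) Q s) := by
    funext s; exact (ratEval_pr h hd (S3_ne s)).2
  rw [e]
  refine ContinuousAt.comp (g := pr) (pr_contAt (ratEval_pr h hd (S3_ne s)).1) ?_
  exact (((homE_cont _ P).comp continuous_subtype_val).prodMk ((homE_cont _ Q).comp continuous_subtype_val)).continuousAt

/-- roots of a polynomial on the sphere, as a form of degree `d` -/
def rts (d : ℕ) (f : ℂ[X]) : Multiset Sphere :=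
  (f.roots.map fun z : ℂ => (z : Sphere)) + Multiset.replicate (d - f.natDegree) (∞ : Sphere)

lemma map_do (m : Multiset ℂ) : (Multiset.map (fun z : Sphere => z) (do let a ← m; pure (a : Sphere))) =
    m.map (fun z : ℂ => (z : Sphere)) := by
  rw [Multiset.map_id']
  simp [Multiset.bind_def, Multiset.pure_def, Multiset.bind_singleton]

def fs (P Q : ℂ[X]) (s : ℂ × ℂ) : ℂ[X] := C s.2 * P - C s.1 * Q

lemma fs_ne {P Q : ℂ[X]} (h : IsCoprime P Q) (hd : 1 ≤ max P.natDegree Q.natDegree)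
    {s : ℂ × ℂ} (hs : s ≠ 0) : fs P Q s ≠ 0 := by
  intro h0
  have h0' : C s.2 * P = C s.1 * Q := sub_eq_zero.1 h0
  have hu : ∀ {A B : ℂ[X]} {c e : ℂ}, IsCoprime A B → c ≠ 0 → C c * A = C e * B →
      max A.natDegree B.natDegree = 0 := by
    intro A B c e hAB hc he
    have hA : A = C (c⁻¹ * e) * B := by
      rw [C_mul, mul_assoc, ← he, ← mul_assoc, ← C_mul, inv_mul_cancel₀ hc]; simp
    have hB : IsUnit B := hAB.isUnit_of_dvd' ⟨_, by rw [hA]; ring⟩ dvd_rfl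
    have hB0 : B.natDegree = 0 := natDegree_eq_zero_of_isUnit hB
    have hA0 : A.natDegree ≤ B.natDegree := by rw [hA]; exact natDegree_C_mul_le _ _
    omega
  by_cases h2 : s.2 = 0
  · have h1 : s.1 ≠ 0 := fun h1 => hs (Prod.ext h1 h2)
    have := hu h.symm h1 h0'.symm
    rw [max_comm] at this; omega
  · have := hu h h2 h0'
    omega

lemma fs_deg (P Q : ℂ[X]) (s : ℂ × ℂ) : (fs P Q s).natDegree ≤ max P.natDegree Q.natDegree := by
  refine (natDegree_sub_le _ _).trans (max_le_max (natDegree_C_mul_le _ _) (natDegree_C_mul_le _ _))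

lemma rts_C_mul (d : ℕ) {c : ℂ} (hc : c ≠ 0) (f : ℂ[X]) : rts d (C c * f) = rts d f := by
  simp [rts, roots_C_mul _ hc, natDegree_C_mul hc]

lemma fiber_pr {P Q : ℂ[X]} {s : ℂ × ℂ} (hs : s ≠ 0) :
    fiber P Q (pr s) = rts (max P.natDegree Q.natDegree) (fs P Q s) := by
  by_cases h2 : s.2 = 0
  · have h1 : s.1 ≠ 0 := fun h1 => hs (Prod.ext h1 h2)
    have e : fs P Q s = C (-s.1) * Q := by simp [fs, h2]
    rw [e, rts_C_mul _ (by simpa using h1)]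
    simp only [pr, h2, fiber, rts, map_do, if_true, if_false, OnePoint.elim_infty, OnePoint.elim_some]
  · have e : fs P Q s = C s.2 * (P - C (s.1 / s.2) * Q) := by
      rw [fs, mul_sub, ← mul_assoc, ← C_mul, mul_div_cancel₀ _ h2]
    rw [e, rts_C_mul _ h2]
    simp only [pr, h2, fiber, rts, map_do, if_true, if_false, OnePoint.elim_infty, OnePoint.elim_some]

lemma rts_card {d : ℕ} {f : ℂ[X]} (h : f.natDegree ≤ d) : (rts d f).card = d := by
  have := (IsAlgClosed.splits f).natDegree_eq_card_roots
  simp [rts, ← this, h]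

lemma rts_mul {d e : ℕ} {f g : ℂ[X]} (hf : f ≠ 0) (hg : g ≠ 0) (hfd : f.natDegree ≤ d) (hge : g.natDegree ≤ e) :
    rts (d + e) (f * g) = rts d f + rts e g := by
  rw [rts, rts, rts, roots_mul (mul_ne_zero hf hg), natDegree_mul hf hg, Multiset.map_add,
    show d + e - (f.natDegree + g.natDegree) = (d - f.natDegree) + (e - g.natDegree) by omega,
    Multiset.replicate_add]
  abel

lemma mem_rts {d : ℕ} {f : ℂ[X]} (hf : f ≠ 0) (h : f.natDegree ≤ d) {s : ℂ × ℂ} (hs : s ≠ 0) :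
    pr s ∈ rts d f ↔ homE d f s = 0 := by
  by_cases h2 : s.2 = 0
  · have h1 : s.1 ≠ 0 := fun h1 => hs (Prod.ext h1 h2)
    rw [homE_of_eq h2]
    have : pr s = (∞ : Sphere) := by simp [pr, h2]
    rw [this]
    simp only [rts, Multiset.mem_add, Multiset.mem_map, OnePoint.coe_ne_infty, and_false, exists_false,
      false_or, Multiset.mem_replicate, and_true, mul_eq_zero, pow_eq_zero_iff', h1, false_and, or_false]
    constructor
    · intro h3; exact coeff_eq_zero_of_natDegree_lt (by omega)
    · intro h3 h4
      have : f.natDegree = d := by omega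
      rw [← this] at h3
      exact hf (by simpa using h3)
  · rw [homE_of_ne h h2]
    have : pr s = ((s.1 / s.2 : ℂ) : Sphere) := by simp [pr, h2]
    rw [this]
    simp [rts, Multiset.mem_replicate, h2, hf, OnePoint.coe_ne_infty]

lemma pr_eq_iff {s t : ℂ × ℂ} (hs : s ≠ 0) (ht : t ≠ 0) : pr s = pr t ↔ s.2 * t.1 - s.1 * t.2 = 0 := by
  have hs' : ¬ (s.1 = 0 ∧ s.2 = 0) := fun h => hs (Prod.ext h.1 h.2)
  have ht' : ¬ (t.1 = 0 ∧ t.2 = 0) := fun h => ht (Prod.ext h.1 h.2)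
  by_cases h2 : s.2 = 0 <;> by_cases h3 : t.2 = 0
  · simp [pr, h2, h3]
  · simp [pr, h2, h3, OnePoint.infty_ne_coe]; tauto
  · simp [pr, h2, h3, OnePoint.coe_ne_infty]; tauto
  · simp only [pr, h2, h3, if_false, OnePoint.coe_eq_coe]
    rw [div_eq_div_iff h2 h3, sub_eq_zero]
    constructor <;> intro h <;> linear_combination -h

lemma homE_fs (d : ℕ) (P Q : ℂ[X]) (s t : ℂ × ℂ) :
    homE d (fs P Q s) t = s.2 * homE d P t - s.1 * homE d Q t := by
  simp only [homE, fs, coeff_sub, coeff_C_mul, Finset.mul_sum, ← Finset.sum_sub_distrib]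
  refine Finset.sum_congr rfl fun k _ => by ring

lemma mem_fiber {P Q : ℂ[X]} (h : IsCoprime P Q) (hd : 1 ≤ max P.natDegree Q.natDegree) (z a : Sphere) :
    z ∈ fiber P Q a ↔ ratEval P Q z = a := by
  obtain ⟨s, rfl⟩ := pr_exists a
  obtain ⟨t, rfl⟩ := pr_exists z
  rw [fiber_pr (S3_ne s), mem_rts (fs_ne h hd (S3_ne s)) (fs_deg _ _ _) (S3_ne t), homE_fs,
    (ratEval_pr h hd (S3_ne t)).2, eq_comm (b := pr s), pr_eq_iff (S3_ne s) (ratEval_pr h hd (S3_ne t)).1]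

lemma card_fiber {P Q : ℂ[X]} (a : Sphere) :
    (fiber P Q a).card = max P.natDegree Q.natDegree := by
  obtain ⟨s, rfl⟩ := pr_exists a
  rw [fiber_pr (S3_ne s), rts_card (fs_deg _ _ _)]

lemma ratEval_surj {P Q : ℂ[X]} (h : IsCoprime P Q) (hd : 1 ≤ max P.natDegree Q.natDegree) :
    Function.Surjective (ratEval P Q) := by
  intro a
  have : (fiber P Q a) ≠ 0 := by
    intro h0
    have := card_fiber (P := P) (Q := Q) a
    rw [h0] at this; simp at this; omega
  obtain ⟨z, hz⟩ := Multiset.exists_mem_of_ne_zero this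
  exact ⟨z, (mem_fiber h hd z a).1 hz⟩

/-! linear factors -/
def lin (t : ℂ × ℂ) : ℂ[X] := C t.2 * X - C t.1

lemma lin_ne {t : ℂ × ℂ} (ht : t ≠ 0) : lin t ≠ 0 := by
  intro h
  have h1 := congrArg (fun f => coeff f 1) h
  have h0 := congrArg (fun f => coeff f 0) h
  simp [lin, coeff_X, coeff_C] at h1 h0
  exact ht (Prod.ext h0 h1)

lemma lin_deg (t : ℂ × ℂ) : (lin t).natDegree ≤ 1 := by
  rw [lin]; compute_degree

lemma rts_lin {t : ℂ × ℂ} (ht : t ≠ 0) : rts 1 (lin t) = {pr t} := by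
  by_cases h2 : t.2 = 0
  · have e : lin t = C (-t.1) := by simp [lin, h2]
    simp [rts, e, pr, h2]
  · have e : lin t = C t.2 * (X - C (t.1 / t.2)) := by
      rw [lin, mul_sub, ← C_mul, mul_div_cancel₀ _ h2]
    rw [e, rts_C_mul _ h2]
    simp [rts, pr, h2]

def linP {d : ℕ} (t : Fin d → ℂ × ℂ) : ℂ[X] := ∏ j, lin (t j)

lemma linP_facts {d : ℕ} (t : Fin d → ℂ × ℂ) (ht : ∀ j, t j ≠ 0) :
    linP t ≠ 0 ∧ (linP t).natDegree ≤ d ∧ rts d (linP t) = Finset.univ.val.map fun j => pr (t j) := by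
  have : ∀ S : Finset (Fin d), (∏ j ∈ S, lin (t j)) ≠ 0 ∧ (∏ j ∈ S, lin (t j)).natDegree ≤ S.card ∧
      rts S.card (∏ j ∈ S, lin (t j)) = S.val.map fun j => pr (t j) := by
    intro S
    induction S using Finset.induction_on with
    | empty => simp [rts]
    | insert a S ha ih =>
      rw [Finset.prod_insert ha, Finset.card_insert_of_notMem ha]
      refine ⟨mul_ne_zero (lin_ne (ht a)) ih.1, ?_, ?_⟩
      · refine natDegree_mul_le.trans ?_
        have := lin_deg (t a); have := ih.2.1; omega
      · rw [add_comm, rts_mul (lin_ne (ht a)) ih.1 (lin_deg _) ih.2.1, ih.2.2, rts_lin (ht a),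
          Finset.insert_val_of_notMem ha]
        simp
  simpa [linP] using this Finset.univ

lemma rts_inj {d : ℕ} {f g : ℂ[X]} (h : rts d f = rts d g) :
    C g.leadingCoeff * f = C f.leadingCoeff * g := by
  have hr : f.roots = g.roots := by
    have e : ∀ (f : ℂ[X]) (z : ℂ), (rts d f).count (z : Sphere) = f.roots.count z := by
      intro f z
      rw [rts, Multiset.count_add, Multiset.count_map_eq_count' _ _ OnePoint.coe_injective,
        Multiset.count_replicate, if_neg (OnePoint.infty_ne_coe z), add_zero]
    ext z
    rw [← e, ← e, h]
  have e1 := (IsAlgClosed.splits f).eq_prod_roots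
  have e2 := (IsAlgClosed.splits g).eq_prod_roots
  conv_lhs => rw [e1, hr]
  conv_rhs => rw [e2]
  ring

def AA (P Q : ℂ[X]) : Set (S3 × (Fin (max P.natDegree Q.natDegree) → S3)) :=
  {x | ∀ a b : ℂ, (fs P Q x.1).eval a * (linP fun j => (x.2 j : ℂ × ℂ)).eval b =
    (fs P Q x.1).eval b * (linP fun j => (x.2 j : ℂ × ℂ)).eval a}

lemma AA_closed (P Q : ℂ[X]) : IsClosed (AA P Q) := by
  simp only [AA, Set.setOf_forall]
  refine isClosed_iInter fun a => isClosed_iInter fun b => isClosed_eq ?_ ?_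
  all_goals
    simp only [fs, linP, eval_prod, lin, eval_sub, eval_mul, eval_C, eval_X]
    fun_prop

lemma AA_fiber {P Q : ℂ[X]} (h : IsCoprime P Q) (hd : 1 ≤ max P.natDegree Q.natDegree)
    {x} (hx : x ∈ AA P Q) : fiber P Q (pr x.1) = Finset.univ.val.map fun j => pr (x.2 j) := by
  obtain ⟨h1, h2, h3⟩ := linP_facts (fun j => (x.2 j : ℂ × ℂ)) (fun j => S3_ne _)
  rw [fiber_pr (S3_ne x.1), ← h3]
  obtain ⟨b, hb⟩ : ∃ b, (linP fun j => (x.2 j : ℂ × ℂ)).eval b ≠ 0 := by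
    by_contra! hc
    exact h1 (Polynomial.funext (by simpa using hc))
  have e : C ((linP fun j => (x.2 j : ℂ × ℂ)).eval b) * fs P Q x.1 =
      C ((fs P Q x.1).eval b) * (linP fun j => (x.2 j : ℂ × ℂ)) := by
    apply Polynomial.funext
    intro a
    have := hx a b
    simp only [eval_mul, eval_C]
    linear_combination this
  have hc : (fs P Q x.1).eval b ≠ 0 := by
    intro h0
    rw [h0] at e
    simp [hb, fs_ne h hd (S3_ne x.1)] at e
  rw [← rts_C_mul _ hb, e, rts_C_mul _ hc]

lemma AA_exists {P Q : ℂ[X]} (s : S3) :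
    ∃ t, (s, t) ∈ AA P Q := by
  have hc := card_fiber (P := P) (Q := Q) (pr s)
  obtain ⟨a, ha⟩ : ∃ a : Fin (max P.natDegree Q.natDegree) → Sphere,
      fiber P Q (pr s) = Finset.univ.val.map a := by
    generalize fiber P Q (pr s) = M at hc
    generalize max P.natDegree Q.natDegree = d at *
    subst hc
    induction M using Quot.inductionOn with
    | h l =>
      refine ⟨fun j => l.get j, ?_⟩
      have : (Finset.univ : Finset (Fin l.length)).val = (List.finRange l.length : Multiset _) := rfl
      change (l : Multiset Sphere) = Multiset.map (fun j : Fin l.length => l.get j) (Finset.univ : Finset (Fin l.length)).val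
      rw [this, Multiset.map_coe, ← List.ofFn_eq_map, List.ofFn_get]
  choose t ht using fun j => pr_exists (a j)
  refine ⟨t, ?_⟩
  obtain ⟨h1, h2, h3⟩ := linP_facts (fun j => (t j : ℂ × ℂ)) (fun j => S3_ne _)
  have h4 : rts (max P.natDegree Q.natDegree) (fs P Q s) = rts (max P.natDegree Q.natDegree) (linP (fun j => (t j : ℂ × ℂ))) := by
    rw [h3, ← fiber_pr (S3_ne s), ha]; simp only [ht]
  have e := rts_inj h4
  intro x y
  have ex := congrArg (eval x) e
  have ey := congrArg (eval y) e
  simp only [eval_mul, eval_C] at ex ey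
  have hl := leadingCoeff_ne_zero.2 h1
  apply mul_left_cancel₀ hl
  dsimp only
  linear_combination (eval y (linP fun j => (t j : ℂ × ℂ))) * ex - (eval x (linP fun j => (t j : ℂ × ℂ))) * ey

lemma fiberSum_cont {W : Type*} [TopologicalSpace W] [CompactSpace W] [T2Space W] {P Q : ℂ[X]}
    (h : IsCoprime P Q) (hd : 1 ≤ max P.natDegree Q.natDegree) (H : W × Sphere → ℝ) (hH : Continuous H) :
    Continuous fun x : W × Sphere => ((fiber P Q x.2).map fun ζ => H (x.1, ζ)).sum := by
  haveI : CompactSpace (AA P Q) := isCompact_iff_compactSpace.1 (AA_closed P Q).isCompact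
  let φ : W × AA P Q → W × Sphere := fun y => (y.1, pr y.2.1.1)
  have hφ : Continuous φ := continuous_fst.prodMk (pr_cont.comp (continuous_fst.comp (continuous_subtype_val.comp continuous_snd)))
  have hs : Function.Surjective φ := by
    rintro ⟨w, z⟩
    obtain ⟨s, rfl⟩ := pr_exists z
    obtain ⟨t, ht⟩ := AA_exists (P := P) (Q := Q) s
    exact ⟨(w, ⟨_, ht⟩), rfl⟩
  rw [(hφ.isClosedMap.isQuotientMap hφ hs).continuous_iff]
  have e : (fun x : W × Sphere => ((fiber P Q x.2).map fun ζ => H (x.1, ζ)).sum) ∘ φ =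
      fun y => ∑ j, H (y.1, pr (y.2.1.2 j)) := by
    funext y
    simp only [φ, Function.comp, AA_fiber h hd y.2.2, Multiset.map_map]
    rfl
  rw [e]
  refine continuous_finsetSum _ fun j _ => hH.comp (continuous_fst.prodMk (pr_cont.comp ?_))
  exact (continuous_apply j).comp (continuous_snd.comp (continuous_subtype_val.comp continuous_snd))

lemma bump {Y : Type*} [TopologicalSpace Y] [NormalSpace Y] [T1Space Y] {U : Set Y} (hU : IsOpen U) {y : Y} (hy : y ∈ U) :
    ∃ b : C(Y, ℝ), b y = 1 ∧ (∀ x ∉ U, b x = 0) ∧ ∀ x, b x ∈ Set.Icc (0:ℝ) 1 := by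
  obtain ⟨b, h0, h1, h2⟩ := exists_continuous_zero_one_of_isClosed hU.isClosed_compl (isClosed_singleton (x := y))
    (by simpa using hy)
  exact ⟨b, h1 rfl, fun x hx => h0 hx, h2⟩

lemma msum_nonneg {α : Type*} (s : Multiset α) (f : α → ℝ) (hf : ∀ x, 0 ≤ f x) : 0 ≤ (s.map f).sum :=
  Multiset.sum_nonneg (by simpa using fun a _ => hf a)

lemma msum_ge {α : Type*} (s : Multiset α) (f : α → ℝ) (hf : ∀ x, 0 ≤ f x) {a : α} (ha : a ∈ s) :
    f a ≤ (s.map f).sum := by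
  obtain ⟨t, rfl⟩ := Multiset.exists_cons_of_mem ha
  simpa using msum_nonneg t f hf

lemma msum_pos_ex {α : Type*} (s : Multiset α) (f : α → ℝ) (h : 0 < (s.map f).sum) : ∃ a ∈ s, f a ≠ 0 := by
  by_contra! hc
  rw [Multiset.map_congr rfl hc] at h
  simp at h

lemma ratEval_open {P Q : ℂ[X]} (h : IsCoprime P Q) (hd : 1 ≤ max P.natDegree Q.natDegree) :
    IsOpenMap (ratEval P Q) := by
  intro U hU
  rw [isOpen_iff_mem_nhds]
  rintro _ ⟨y, hy, rfl⟩
  obtain ⟨b, b1, b0, bI⟩ := bump hU hy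
  have hc : Continuous fun z : Sphere => ((fiber P Q z).map fun ζ => b ζ).sum :=
    (fiberSum_cont (W := Unit) h hd (fun x => b x.2) (by fun_prop)).comp ((continuous_const (y := ())).prodMk continuous_id)
  refine Filter.mem_of_superset ((isOpen_Ioi (a := (0:ℝ))).preimage hc |>.mem_nhds ?_) ?_
  · have := msum_ge (fiber P Q (ratEval P Q y)) b (fun x => (bI x).1) ((mem_fiber h hd _ _).2 rfl)
    simp only [Set.mem_preimage, Set.mem_Ioi]
    linarith
  · intro z hz
    obtain ⟨a, ha, hb⟩ := msum_pos_ex _ _ hz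
    refine ⟨a, by_contra fun hn => hb (b0 a hn), (mem_fiber h hd _ _).1 ha⟩


/-! ### The skew product and transfer operator -/
instance : SecondCountableTopology Sphere := emb_emb.secondCountableTopology

lemma Good.cop (hg : Good p q) (i) : IsCoprime (p i) (q i) := hg.2.1 i
lemma Good.deg (hg : Good p q) (i) : 1 ≤ max (p i).natDegree (q i).natDegree := hg.2.2.1 i
lemma Good.D2 (hg : Good p q) : 2 ≤ Dtot p q := by
  obtain ⟨i, hi⟩ := hg.2.2.2
  exact hi.trans (Finset.single_le_sum (f := fun i => degR p q i) (fun _ _ => Nat.zero_le _) (Finset.mem_univ i))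

lemma shift_cons (v : Fin N) (w : ℕ → Fin N) : shiftW (consW v w) = w := by
  funext n; simp [shiftW, consW]
lemma cons_zero (v : Fin N) (w : ℕ → Fin N) : consW v w 0 = v := by simp [consW]
lemma cons_shift (w : ℕ → Fin N) : consW (w 0) (shiftW w) = w := by
  funext n; cases n <;> simp [shiftW, consW]

lemma shift_cont : Continuous (shiftW (N := N)) := by
  unfold shiftW; fun_prop
lemma cons_cont (v : Fin N) : Continuous (consW v) := by
  refine continuous_pi fun n => ?_
  by_cases hn : n = 0
  · simp only [consW, hn, if_true]; fun_prop
  · simp only [consW, hn, if_false]; fun_prop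

lemma T_cont (hg : Good p q) : Continuous (Tmap p q) := by
  refine (shift_cont.comp continuous_fst).prodMk ?_
  have : Continuous fun y : Fin N × Sphere => ratEval (p y.1) (q y.1) y.2 :=
    continuous_prod_of_discrete_left.2 fun i => ratEval_cont (hg.cop i) (hg.deg i)
  have h2 : Continuous fun x : SymX N => ((x.1 0, x.2) : Fin N × Sphere) := by fun_prop
  exact this.comp h2

lemma preimT_sum (h : SymX N → ℝ) (x : SymX N) : ((preimT p q x).map h).sum =
    ∑ v, ((fiber (p v) (q v) x.2).map fun z => h (consW v x.1, z)).sum := by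
  have := map_sum ((Multiset.sumAddMonoidHom (M := ℝ)).comp (Multiset.mapAddMonoidHom h))
    (fun v : Fin N => (fiber (p v) (q v) x.2).map fun z => (consW v x.1, z)) Finset.univ
  simp only [AddMonoidHom.comp_apply, Multiset.coe_sumAddMonoidHom, Multiset.coe_mapAddMonoidHom,
    Multiset.map_map] at this
  exact this

lemma mem_preimT (hg : Good p q) (y x : SymX N) : y ∈ preimT p q x ↔ Tmap p q y = x := by
  rw [preimT, Multiset.mem_sum]
  simp only [Finset.mem_univ, true_and, Multiset.mem_map]
  constructor
  · rintro ⟨v, z, hz, rfl⟩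
    rw [mem_fiber (hg.cop v) (hg.deg v)] at hz
    simp only [Tmap, shift_cons, cons_zero, hz]
  · rintro rfl
    exact ⟨y.1 0, y.2, (mem_fiber (hg.cop _) (hg.deg _) _ _).2 rfl, Prod.ext (cons_shift _) rfl⟩

lemma card_preimT (x : SymX N) : (preimT p q x).card = Dtot p q := by
  rw [preimT, Multiset.card_sum]
  simp [Dtot, degR, card_fiber]

variable (p q) in
def SS (h : SymX N → ℝ) (x : SymX N) : ℝ := (Dtot p q : ℝ)⁻¹ * ((preimT p q x).map h).sum

lemma SS_cont (hg : Good p q) {h : SymX N → ℝ} (hh : Continuous h) : Continuous (SS p q h) := by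
  unfold SS
  simp only [preimT_sum]
  refine continuous_const.mul (continuous_finsetSum _ fun v _ => ?_)
  exact fiberSum_cont (W := ℕ → Fin N) (hg.cop v) (hg.deg v) (fun x => h (consW v x.1, x.2))
    (hh.comp (((cons_cont v).comp continuous_fst).prodMk continuous_snd))

lemma SSn_cont (hg : Good p q) {h : SymX N → ℝ} (hh : Continuous h) (n : ℕ) : Continuous ((SS p q)^[n] h) := by
  induction n with
  | zero => exact hh
  | succ n ih => rw [Function.iterate_succ_apply']; exact SS_cont hg ih

lemma SS_nonneg {h : SymX N → ℝ} (hh : ∀ x, 0 ≤ h x) (x) : 0 ≤ SS p q h x :=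
  mul_nonneg (by positivity) (msum_nonneg _ _ hh)

lemma SS_le (hg : Good p q) {h : SymX N → ℝ} {M : ℝ} (hh : ∀ x, h x ≤ M) (x) : SS p q h x ≤ M := by
  have h1 : ((preimT p q x).map h).sum ≤ ((preimT p q x).map fun _ => M).sum :=
    Multiset.sum_map_le_sum_map _ _ (fun y _ => hh y)
  have hD : (0:ℝ) < Dtot p q := by have := hg.D2; exact_mod_cast (by omega)
  simp only [Multiset.map_const', card_preimT, Multiset.sum_replicate, nsmul_eq_mul] at h1
  rw [SS, inv_mul_le_iff₀ hD]; exact h1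

lemma SS_pull (hg : Good p q) (f h : SymX N → ℝ) : SS p q (fun y => f (Tmap p q y) * h y) = fun x => f x * SS p q h x := by
  funext x
  have : (preimT p q x).map (fun y => f (Tmap p q y) * h y) = (preimT p q x).map (fun y => f x * h y) :=
    Multiset.map_congr rfl fun y hy => by rw [(mem_preimT hg y x).1 hy]
  rw [SS, SS, this, Multiset.sum_map_mul_left]; ring

lemma SS_one (hg : Good p q) : SS p q (fun _ => 1) = fun _ => 1 := by
  funext x
  have hD : (Dtot p q : ℝ) ≠ 0 := by have := hg.D2; exact_mod_cast (by omega)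
  simp [SS, card_preimT, hD]

lemma SS_n (hg : Good p q) (h : SymX N → ℝ) (n : ℕ) (x : SymX N) :
    ((Dtot p q : ℝ) ^ n)⁻¹ * ((preimTn p q n x).map h).sum = (SS p q)^[n] h x := by
  have hD : (Dtot p q : ℝ) ≠ 0 := by have := hg.D2; exact_mod_cast (by omega)
  induction n generalizing x with
  | zero => simp [preimTn]
  | succ n ih =>
    rw [Function.iterate_succ_apply', SS, preimTn, Multiset.map_bind, Multiset.sum_bind]
    have : (fun y => (SS p q)^[n] h y) = fun y => ((Dtot p q : ℝ) ^ n)⁻¹ * ((preimTn p q n y).map h).sum := by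
      funext y; rw [ih]
    change _ = _ * (Multiset.map (fun y => (SS p q)^[n] h y) _).sum
    rw [this, Multiset.sum_map_mul_left, ← mul_assoc, pow_succ]
    congr 1
    field_simp

lemma SS_supp (hg : Good p q) {J : Set (SymX N)} (hJ : ∀ y, Tmap p q y ∈ J → y ∈ J) {h : SymX N → ℝ}
    (hh : ∀ x ∈ J, h x = 0) : ∀ x ∈ J, SS p q h x = 0 := by
  intro x hx
  have : (preimT p q x).map h = (preimT p q x).map fun _ => 0 :=
    Multiset.map_congr rfl fun y hy => hh _ (hJ _ (by rw [(mem_preimT hg y x).1 hy]; exact hx))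
  simp [SS, this]

variable (p q) in
def mlt (y : SymX N) : ℕ := (fiber (p (y.1 0)) (q (y.1 0)) (ratEval (p (y.1 0)) (q (y.1 0)) y.2)).count y.2

lemma mlt_le (y : SymX N) : mlt p q y ≤ Dtot p q := by
  refine (Multiset.count_le_card _ _).trans ?_
  rw [card_fiber]
  exact (Finset.single_le_sum (f := fun i => degR p q i) (fun _ _ => Nat.zero_le _) (Finset.mem_univ (y.1 0)))

lemma sum_ite_count {α : Type*} (s : Multiset α) (a : α) :
    (s.map fun z => if z = a then (1:ℝ) else 0).sum = s.count a := by
  induction s using Multiset.induction_on with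
  | empty => simp
  | cons b s ih =>
    rw [Multiset.map_cons, Multiset.sum_cons, ih, Multiset.count_cons]
    by_cases h : b = a
    · simp [h]; ring
    · simp [h, Ne.symm h]

lemma SS_mlt (hg : Good p q) {h : SymX N → ℝ} {y : SymX N} (h1 : h y = 1)
    (h0 : ∀ y', Tmap p q y' = Tmap p q y → y' ≠ y → h y' = 0) :
    SS p q h (Tmap p q y) = mlt p q y / Dtot p q := by
  rw [SS, preimT_sum, Finset.sum_eq_single (y.1 0)]
  · rw [mlt, ← sum_ite_count, mul_comm, div_eq_mul_inv]
    congr 2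
    refine Multiset.map_congr rfl fun z hz => ?_
    have e := (mem_fiber (hg.cop _) (hg.deg _) _ _).1 hz
    have e1 : consW (y.1 0) (Tmap p q y).1 = y.1 := cons_shift _
    rw [e1]
    by_cases hzy : z = y.2
    · rw [if_pos hzy, hzy]; exact h1
    · rw [if_neg hzy]
      refine h0 _ ?_ ?_
      · exact Prod.ext rfl e
      · intro hh; exact hzy (congrArg Prod.snd hh)
  · intro v _ hv
    have : Multiset.map (fun z => h (consW v (Tmap p q y).1, z)) (fiber (p v) (q v) (Tmap p q y).2) =
      Multiset.map (fun z => 0) (fiber (p v) (q v) (Tmap p q y).2) := by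
      refine Multiset.map_congr rfl fun z hz => ?_
      have e := (mem_fiber (hg.cop _) (hg.deg _) _ _).1 hz
      refine h0 _ ?_ ?_
      · refine Prod.ext (shift_cons v _) ?_
        simp only [Tmap, cons_zero] at e ⊢
        exact e
      · intro hh
        have := congrFun (congrArg Prod.fst hh) 0
        simp only [cons_zero] at this
        exact hv this
    rw [this]; simp
  · simp

lemma bump_SS (hg : Good p q) {b : SymX N → ℝ} (hb : ∀ x, 0 ≤ b x) {y : SymX N} (hy : b y = 1) :
    0 < SS p q b (Tmap p q y) := by
  have hD : (0:ℝ) < Dtot p q := by have := hg.D2; exact_mod_cast (by omega)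
  have := msum_ge (preimT p q (Tmap p q y)) b hb ((mem_preimT hg _ _).2 rfl)
  exact mul_pos (inv_pos.2 hD) (by linarith)

lemma T_open (hg : Good p q) : IsOpenMap (Tmap p q) := by
  intro U hU
  rw [isOpen_iff_mem_nhds]
  rintro _ ⟨y, hy, rfl⟩
  obtain ⟨b, b1, b0, bI⟩ := bump hU hy
  refine Filter.mem_of_superset ((isOpen_Ioi (a := (0:ℝ))).preimage (SS_cont hg b.continuous) |>.mem_nhds ?_) ?_
  · exact bump_SS hg (fun x => (bI x).1) b1
  · intro z hz
    have hz' : 0 < (Dtot p q : ℝ)⁻¹ * ((preimT p q z).map b).sum := hz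
    have : 0 < ((preimT p q z).map b).sum := pos_of_mul_pos_right hz' (by positivity)
    obtain ⟨a, ha, hb⟩ := msum_pos_ex _ _ this
    exact ⟨a, by_contra fun hn => hb (b0 a hn), (mem_preimT hg _ _).1 ha⟩


/-! ### Measure theory -/
variable (p q) in
def LimM (J : Set (SymX N)) (μ : Measure (SymX N)) : Prop :=
  ∀ x ∈ J, ∀ g : SymX N → ℝ, Continuous g → Tendsto (fun n => (SS p q)^[n] g x) atTop (𝓝 (∫ y, g y ∂μ))

lemma int_SS (hg : Good p q) {J : Set (SymX N)} (hJn : J.Nonempty) {μ : Measure (SymX N)}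
    (hμ : LimM p q J μ) {h : SymX N → ℝ} (hh : Continuous h) : ∫ x, SS p q h x ∂μ = ∫ x, h x ∂μ := by
  obtain ⟨x, hx⟩ := hJn
  have h1 := hμ x hx _ (SS_cont hg hh)
  have h2 := (tendsto_add_atTop_iff_nat 1).2 (hμ x hx _ hh)
  refine tendsto_nhds_unique h1 (h2.congr fun n => ?_)
  rw [Function.iterate_succ_apply]

lemma int_cont {μ : Measure (SymX N)} [IsProbabilityMeasure μ] {h : SymX N → ℝ} (hh : Continuous h) : Integrable h μ := by
  have := hh.integrable_of_hasCompactSupport (μ := μ) (HasCompactSupport.of_compactSpace h)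
  exact this

lemma meas_cont {h : SymX N → ℝ} (hh : Continuous h) : Measurable fun x => ENNReal.ofReal (h x) :=
  ENNReal.measurable_ofReal.comp hh.measurable

lemma nu (hg : Good p q) {J : Set (SymX N)} (hJn : J.Nonempty) {μ : Measure (SymX N)} [IsProbabilityMeasure μ]
    (hμ : LimM p q J μ) {h : SymX N → ℝ} (hh : Continuous h) (h0 : ∀ x, 0 ≤ h x) {A : Set (SymX N)}
    (hA : MeasurableSet A) :
    ∫⁻ x in Tmap p q ⁻¹' A, ENNReal.ofReal (h x) ∂μ = ∫⁻ x in A, ENNReal.ofReal (SS p q h x) ∂μ := by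
  have hT : Measurable (Tmap p q) := (T_cont hg).measurable
  have hS := SS_cont hg hh
  have fin : ∀ {f : SymX N → ℝ}, Continuous f → IsFiniteMeasure (μ.withDensity fun x => ENNReal.ofReal (f x)) := by
    intro f hf
    exact isFiniteMeasure_withDensity_ofReal (int_cont hf).2
  haveI := fin hh
  haveI := fin hS
  have key : (μ.withDensity fun x => ENNReal.ofReal (h x)).map (Tmap p q) =
      μ.withDensity fun x => ENNReal.ofReal (SS p q h x) := by
    haveI : IsFiniteMeasure ((μ.withDensity fun x => ENNReal.ofReal (h x)).map (Tmap p q)) :=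
      Measure.isFiniteMeasure_map _ _
    apply ext_of_forall_integral_eq_of_IsFiniteMeasure
    intro f
    have hf := f.continuous
    rw [integral_map hT.aemeasurable hf.aestronglyMeasurable,
      integral_withDensity_eq_integral_toReal_smul (meas_cont hh) (by simp),
      integral_withDensity_eq_integral_toReal_smul (meas_cont hS) (by simp)]
    have e1 : ∀ x, (ENNReal.ofReal (h x)).toReal • f (Tmap p q x) = f (Tmap p q x) * h x := fun x => by
      rw [ENNReal.toReal_ofReal (h0 x), smul_eq_mul, mul_comm]
    have e2 : ∀ x, (ENNReal.ofReal (SS p q h x)).toReal • f x = f x * SS p q h x := fun x => by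
      rw [ENNReal.toReal_ofReal (SS_nonneg h0 x), smul_eq_mul, mul_comm]
    simp only [e1, e2]
    rw [← int_SS hg hJn hμ (h := fun x => f (Tmap p q x) * h x) ((hf.comp (T_cont hg)).mul hh)]
    exact congrArg (fun F : SymX N → ℝ => ∫ x, F x ∂μ) (SS_pull hg f h)
  rw [← withDensity_apply _ (hT hA), ← withDensity_apply _ hA, ← key, Measure.map_apply hT hA]

lemma inv_of (hg : Good p q) {J : Set (SymX N)} (hJn : J.Nonempty) {μ : Measure (SymX N)} [IsProbabilityMeasure μ]
    (hμ : LimM p q J μ) {A : Set (SymX N)} (hA : MeasurableSet A) : μ (Tmap p q ⁻¹' A) = μ A := by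
  have := nu hg hJn hμ (h := fun _ => 1) continuous_const (fun _ => zero_le_one) hA
  simpa [SS_one hg] using this

lemma erg_of (hg : Good p q) {J : Set (SymX N)} (hJn : J.Nonempty) {μ : Measure (SymX N)} [IsProbabilityMeasure μ]
    (hμ : LimM p q J μ) (hJ0 : μ Jᶜ = 0) {A : Set (SymX N)} (hA : MeasurableSet A) (hT : Tmap p q ⁻¹' A = A) :
    μ A = 0 ∨ μ A = 1 := by
  have key : ∀ h : SymX N → ℝ, Continuous h → (∀ x, 0 ≤ h x) →
      ∫⁻ x in A, ENNReal.ofReal (h x) ∂μ = ENNReal.ofReal (∫ x, h x ∂μ) * μ A := by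
    intro h hh h0
    have hn0 : ∀ n x, 0 ≤ (SS p q)^[n] h x := by
      intro n
      induction n with
      | zero => exact h0
      | succ n ih => intro x; rw [Function.iterate_succ_apply']; exact SS_nonneg ih x
    obtain ⟨M, hM⟩ : ∃ M, ∀ x, h x ≤ M := by
      obtain ⟨M, hM⟩ := (isCompact_range hh).bddAbove
      exact ⟨M, fun x => hM ⟨x, rfl⟩⟩
    have hnM : ∀ n x, (SS p q)^[n] h x ≤ M := by
      intro n
      induction n with
      | zero => exact hM
      | succ n ih => intro x; rw [Function.iterate_succ_apply']; exact SS_le hg ih x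
    have hc : ∀ n, ∫⁻ x in A, ENNReal.ofReal ((SS p q)^[n] h x) ∂μ = ∫⁻ x in A, ENNReal.ofReal (h x) ∂μ := by
      intro n
      induction n with
      | zero => rfl
      | succ n ih =>
        rw [← ih]
        have := nu hg hJn hμ (SSn_cont hg hh n) (hn0 n) hA
        rw [hT] at this
        rw [this, Function.iterate_succ_apply']
    have hlim : Tendsto (fun n => ∫⁻ x in A, ENNReal.ofReal ((SS p q)^[n] h x) ∂μ) atTop
        (𝓝 (∫⁻ x in A, ENNReal.ofReal (∫ x, h x ∂μ) ∂μ)) := by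
      refine tendsto_lintegral_of_dominated_convergence (fun _ => ENNReal.ofReal M)
        (fun n => meas_cont (SSn_cont hg hh n)) (fun n => Eventually.of_forall fun x => ?_) ?_ ?_
      · exact ENNReal.ofReal_le_ofReal (hnM n x)
      · simp [ENNReal.mul_eq_top]
      · have : ∀ᵐ x ∂μ, x ∈ J := by rw [ae_iff]; exact hJ0
        filter_upwards [ae_restrict_of_ae this] with x hx
        exact ENNReal.tendsto_ofReal (hμ x hx h hh)
    simp only [hc] at hlim
    rw [tendsto_nhds_unique tendsto_const_nhds hlim]
    simp
  have hr : μ.restrict A = μ A • μ := by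
    apply ext_of_forall_lintegral_eq_of_IsFiniteMeasure
    intro f
    have hfc : Continuous fun x => (f x : ℝ) := by fun_prop
    have := key (fun x => (f x : ℝ)) hfc (fun x => (f x).2)
    rw [ofReal_integral_eq_lintegral_ofReal (int_cont hfc) (Eventually.of_forall fun x => (f x).2)] at this
    simp only [ENNReal.ofReal_coe_nnreal] at this
    rw [this, lintegral_smul_measure, smul_eq_mul, mul_comm]
  have h1 := congrArg (fun ν : Measure (SymX N) => ν Aᶜ) hr
  simp only [Measure.restrict_apply hA.compl, Set.compl_inter_self, measure_empty, Measure.smul_apply, smul_eq_mul] at h1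
  rcases mul_eq_zero.1 h1.symm with h | h
  · exact Or.inl h
  · right; exact (prob_compl_eq_zero_iff hA).1 h

lemma null_of_bump {μ : Measure (SymX N)} {C : Set (SymX N)}
    (h : ∀ x ∈ C, ∃ b : SymX N → ℝ, Continuous b ∧ 0 < b x ∧ ∫⁻ y, ENNReal.ofReal (b y) ∂μ = 0) : μ C = 0 := by
  refine measure_null_of_locally_null C fun x hx => ?_
  obtain ⟨b, hb, hx0, hi⟩ := h x hx
  refine ⟨{y | 0 < b y}, mem_nhdsWithin_of_mem_nhds ((isOpen_lt continuous_const hb).mem_nhds hx0), ?_⟩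
  rw [lintegral_eq_zero_iff (meas_cont hb)] at hi
  have := ae_iff.1 hi
  refine measure_mono_null (fun y hy => ?_) this
  simpa using hy

lemma J0_of (hg : Good p q) {J : Set (SymX N)} (hJc : IsClosed J) (hJn : J.Nonempty)
    (hJ : ∀ y, Tmap p q y ∈ J → y ∈ J) {μ : Measure (SymX N)} [IsProbabilityMeasure μ]
    (hμ : LimM p q J μ) : μ Jᶜ = 0 := by
  refine null_of_bump fun x hx => ?_
  obtain ⟨b, b1, b0, bI⟩ := bump hJc.isOpen_compl hx
  refine ⟨b, b.continuous, by rw [b1]; norm_num, ?_⟩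
  rw [← ofReal_integral_eq_lintegral_ofReal (int_cont b.continuous) (Eventually.of_forall fun x => (bI x).1)]
  obtain ⟨x0, hx0⟩ := hJn
  have h1 := hμ x0 hx0 b b.continuous
  have h2 : ∀ n, ∀ x ∈ J, (SS p q)^[n] b x = 0 := by
    intro n
    induction n with
    | zero => exact fun x hx => b0 x (by simpa using hx)
    | succ n ih => rw [Function.iterate_succ_apply']; exact SS_supp hg hJ ih
  simp only [h2 _ x0 hx0] at h1
  rw [tendsto_nhds_unique h1 tendsto_const_nhds]; simp

lemma null_image (hg : Good p q) {J : Set (SymX N)} (hJn : J.Nonempty) {μ : Measure (SymX N)} [IsProbabilityMeasure μ]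
    (hμ : LimM p q J μ) {C : Set (SymX N)} (hC : IsOpen C) (h0 : μ C = 0) : μ (Tmap p q '' C) = 0 := by
  refine null_of_bump ?_
  rintro _ ⟨y, hy, rfl⟩
  obtain ⟨b, b1, b0, bI⟩ := bump hC hy
  refine ⟨SS p q b, SS_cont hg b.continuous, bump_SS hg (fun x => (bI x).1) b1, ?_⟩
  have := nu hg hJn hμ b.continuous (fun x => (bI x).1) MeasurableSet.univ
  simp only [Set.preimage_univ, Measure.restrict_univ] at this
  rw [← this, lintegral_eq_zero_iff (meas_cont b.continuous), EventuallyEq, ae_iff]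
  refine measure_mono_null (fun y hy => ?_) h0
  by_contra hn
  simp [b0 y hn] at hy

lemma atom_rel (hg : Good p q) {J : Set (SymX N)} (hJn : J.Nonempty) {μ : Measure (SymX N)} [IsProbabilityMeasure μ]
    (hμ : LimM p q J μ) (y : SymX N) :
    μ {y} = ENNReal.ofReal (mlt p q y / Dtot p q) * μ {Tmap p q y} := by
  have hfin : {y' | Tmap p q y' = Tmap p q y ∧ y' ≠ y}.Finite := by
    refine Set.Finite.subset (preimT p q (Tmap p q y)).toFinset.finite_toSet ?_
    rintro y' ⟨h, _⟩
    simpa using (mem_preimT hg _ _).2 h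
  obtain ⟨b, b1, b0, bI⟩ := bump hfin.isClosed.isOpen_compl (y := y) (by simp)
  have hb0 : ∀ y', Tmap p q y' = Tmap p q y → y' ≠ y → b y' = 0 := fun y' h1 h2 => b0 y' (by simp [h1, h2])
  have hm : MeasurableSet ({Tmap p q y} : Set (SymX N)) := isClosed_singleton.measurableSet
  have hmy : MeasurableSet ({y} : Set (SymX N)) := isClosed_singleton.measurableSet
  have hpre : MeasurableSet (Tmap p q ⁻¹' {Tmap p q y}) := (T_cont hg).measurable hm
  have := nu hg hJn hμ b.continuous (fun x => (bI x).1) hm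
  rw [setLIntegral_congr_fun (g := Set.indicator {y} (fun _ => 1)) hpre ?_,
    setLIntegral_congr_fun (g := fun _ => ENNReal.ofReal (mlt p q y / Dtot p q)) hm ?_] at this
  · rw [lintegral_indicator hmy, lintegral_const, lintegral_const, Measure.restrict_apply MeasurableSet.univ,
      Measure.restrict_apply MeasurableSet.univ, Measure.restrict_apply' hpre] at this
    simp only [Set.univ_inter, one_mul] at this
    rw [← this]; congr 1; ext z; simp
  · intro x hx
    rw [Set.mem_singleton_iff.1 hx]
    simp only
    rw [SS_mlt hg b1 hb0]
  · intro x hx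
    by_cases hxy : x = y
    · simp [hxy, b1]
    · simp [hxy, hb0 x hx hxy]

lemma nonatomic_of (hg : Good p q) {J : Set (SymX N)} (hJn : J.Nonempty) {μ : Measure (SymX N)} [IsProbabilityMeasure μ]
    (hμ : LimM p q J μ) (hJ0 : μ Jᶜ = 0)
    (hA1 : ∀ x ∈ J, ∀ m : ℕ, 1 ≤ m → (Tmap p q)^[m] x = x → mlt p q x < 2) (x : SymX N) : μ {x} = 0 := by
  by_contra hx
  have hms : ∀ y : SymX N, MeasurableSet ({y} : Set (SymX N)) := fun y => isClosed_singleton.measurableSet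
  have hfin : {y | μ {x} ≤ μ {y}}.Finite :=
    Measure.finite_const_le_meas_of_disjoint_iUnion μ (pos_iff_ne_zero.2 hx) hms
      (fun a b hab => by simpa using hab) (measure_ne_top _ _)
  obtain ⟨y, hy, hmax⟩ := hfin.exists_maximalFor (fun y => μ {y}) _ ⟨x, le_refl (μ {x})⟩
  have hmax' : ∀ z, μ {z} ≤ μ {y} := by
    intro z
    rcases le_total (μ {z}) (μ {y}) with h | h
    · exact h
    · exact hmax (le_trans hy h) h
  have hpos : 0 < μ {y} := (pos_iff_ne_zero.2 hx).trans_le hy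
  have hD : (0:ℝ) < Dtot p q := by have := hg.D2; exact_mod_cast (by omega)
  have step : ∀ z, μ {z} = μ {y} → μ {Tmap p q z} = μ {y} ∧ mlt p q z = Dtot p q := by
    intro z hz
    have h1 := atom_rel hg hJn hμ z
    rw [hz] at h1
    have hle := hmax' (Tmap p q z)
    have hml : (mlt p q z : ℝ) ≤ Dtot p q := by exact_mod_cast mlt_le z
    have hr : ENNReal.ofReal (mlt p q z / Dtot p q) ≤ 1 := by
      rw [ENNReal.ofReal_le_one, div_le_one hD]; exact hml
    have h2 : μ {y} ≤ μ {Tmap p q z} := by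
      calc μ {y} = _ := h1
        _ ≤ 1 * μ {Tmap p q z} := by gcongr
        _ = _ := one_mul _
    have h3 := le_antisymm hle h2
    refine ⟨h3, ?_⟩
    rw [h3] at h1
    have h4 : ENNReal.ofReal (mlt p q z / Dtot p q) = 1 := by
      have : 1 * μ {y} = ENNReal.ofReal (mlt p q z / Dtot p q) * μ {y} := by rw [one_mul]; exact h1
      exact ((ENNReal.mul_left_inj hpos.ne' (measure_ne_top _ _)).1 this).symm
    rw [ENNReal.ofReal_eq_one, div_eq_one_iff_eq hD.ne'] at h4
    exact_mod_cast h4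
  have orb : ∀ n, μ {(Tmap p q)^[n] y} = μ {y} := by
    intro n
    induction n with
    | zero => rfl
    | succ n ih => rw [Function.iterate_succ_apply']; exact (step _ ih).1
  obtain ⟨i, j, hij, he⟩ : ∃ i j : ℕ, i < j ∧ (Tmap p q)^[i] y = (Tmap p q)^[j] y := by
    have hmem : ∀ n, (Tmap p q)^[n] y ∈ {y | μ {x} ≤ μ {y}} := fun n => by
      simp only [Set.mem_setOf_eq, orb]; exact hy
    obtain ⟨i, _, j, _, hne, he⟩ := Set.infinite_univ.exists_ne_map_eq_of_mapsTo (f := fun n : ℕ => (Tmap p q)^[n] y)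
      (fun n _ => hmem n) hfin
    rcases lt_or_gt_of_ne hne with h | h
    · exact ⟨i, j, h, he⟩
    · exact ⟨j, i, h, he.symm⟩
  set z := (Tmap p q)^[i] y with hz
  have hzJ : z ∈ J := by
    by_contra hn
    have : μ {z} = 0 := measure_mono_null (by simpa using hn) hJ0
    rw [hz, orb] at this
    exact hpos.ne' this
  have hper : (Tmap p q)^[j - i] z = z := by
    rw [hz, ← Function.iterate_add_apply, Nat.sub_add_cancel hij.le, ← he]
  have h5 := hA1 z hzJ (j - i) (by omega) hper
  have h6 := (step z (orb i)).2
  have := hg.D2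
  omega


/-! ### Julia set -/
lemma sph_tri (a b c : Sphere) : sphDist a c ≤ sphDist a b + sphDist b c := by
  simp only [sphDist_eq]; exact dist_triangle _ _ _
lemma sph_comm (a b : Sphere) : sphDist a b = sphDist b a := by
  simp only [sphDist_eq]; exact dist_comm _ _
lemma sph_pos {a b : Sphere} (h : a ≠ b) : 0 < sphDist a b := by
  rw [sphDist_eq]; exact dist_pos.2 fun h' => h (emb_inj h')

lemma itComp_cont (hg : Good p q) (w : ℕ → Fin N) (n : ℕ) : Continuous (itComp p q w n) := by
  induction n with
  | zero => exact continuous_id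
  | succ n ih => exact (ratEval_cont (hg.cop _) (hg.deg _)).comp ih

lemma itComp_succ' (w : ℕ → Fin N) (n : ℕ) :
    itComp p q w (n + 1) = itComp p q (shiftW w) n ∘ ratEval (p (w 0)) (q (w 0)) := by
  induction n with
  | zero => rfl
  | succ n ih =>
    rw [itComp, ih, itComp]; rfl

lemma fatou_fwd (hg : Good p q) {w : ℕ → Fin N} {z : Sphere} (hz : z ∈ fatouW p q w) :
    ratEval (p (w 0)) (q (w 0)) z ∈ fatouW p q (shiftW w) := by
  obtain ⟨U, hU, hzU, hN⟩ := hz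
  obtain ⟨K, hK, hzK, hKU⟩ := exists_compact_subset hU hzU
  set R := ratEval (p (w 0)) (q (w 0)) with hR
  refine ⟨R '' interior K, ratEval_open (hg.cop _) (hg.deg _) _ isOpen_interior, ⟨z, hzK, rfl⟩, ?_⟩
  intro s hs
  obtain ⟨φ, hφ, g, hgl⟩ := hN (fun n => s n ∘ R) (by
    intro n
    obtain ⟨m, hm, e⟩ := hs n
    exact ⟨m + 1, by omega, by rw [itComp_succ', e]⟩)
  choose! sec hsec using fun (y : Sphere) (hy : y ∈ R '' interior K) => hy
  refine ⟨φ, hφ, fun y => g (sec y), ?_⟩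
  intro K' hK' _ ε hε
  filter_upwards [hgl K hKU hK ε hε] with n hn y hy
  have h1 := hsec y (hK' hy)
  have h2 := hn (sec y) (interior_subset h1.1)
  simp only [Function.comp, h1.2] at h2
  exact h2

lemma julia_back (hg : Good p q) (y : SymX N) (hy : Tmap p q y ∈ juliaSet p q) : y ∈ juliaSet p q := by
  have h1 := (T_open hg).preimage_closure_subset_closure_preimage (s := ⋃ w : ℕ → Fin N, {w} ×ˢ juliaW p q w) hy
  refine closure_mono ?_ h1
  intro x hx
  simp only [Set.mem_preimage, Set.mem_iUnion, Set.mem_prod, Set.mem_singleton_iff] at hx ⊢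
  obtain ⟨w, hw, hz⟩ := hx
  refine ⟨x.1, rfl, fun hf => hz ?_⟩
  rw [← hw]
  exact fatou_fwd hg hf

lemma count_rts (d : ℕ) (f : ℂ[X]) (z : ℂ) : (rts d f).count (z : Sphere) = f.roots.count z := by
  rw [rts, Multiset.count_add, Multiset.count_map_eq_count' _ _ OnePoint.coe_injective,
    Multiset.count_replicate, if_neg (OnePoint.infty_ne_coe z), add_zero]

lemma not_inj {P Q : ℂ[X]} (h : IsCoprime P Q) (hd : 2 ≤ max P.natDegree Q.natDegree) :
    ∃ u v, u ≠ v ∧ ratEval P Q u = ratEval P Q v := by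
  by_contra! hc
  have hd1 : 1 ≤ max P.natDegree Q.natDegree := by omega
  have hW : wronskian P Q ≠ 0 := by
    intro h0
    rw [h.wronskian_eq_zero_iff] at h0
    have h1 := natDegree_eq_zero_of_derivative_eq_zero h0.1
    have h2 := natDegree_eq_zero_of_derivative_eq_zero h0.2
    omega
  have hfin : {b : ℂ | (b : Sphere) ≠ ratEval P Q ∞}.Finite := by
    have h1 : {z | (wronskian P Q).IsRoot z}.Finite := finite_setOf_isRoot hW
    have h2 := (h1.image (fun z : ℂ => ratEval P Q z)).preimage (f := fun z : ℂ => (z : Sphere))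
      (OnePoint.coe_injective.injOn)
    refine h2.subset ?_
    intro b hb
    obtain ⟨ζ, hζ⟩ := ratEval_surj h hd1 (b : Sphere)
    induction ζ using OnePoint.rec with
    | infty => exact absurd hζ.symm hb
    | coe z =>
      refine ⟨z, ?_, hζ⟩
      have hcount : (fiber P Q (b : Sphere)).count (z : Sphere) = max P.natDegree Q.natDegree := by
        rw [← card_fiber (P := P) (Q := Q) (b : Sphere), Multiset.count_eq_card]
        intro x hx
        by_contra hne
        exact hc _ _ hne (hζ.trans ((mem_fiber h hd1 _ _).1 hx).symm)
      have hs : ((b, 1) : ℂ × ℂ) ≠ 0 := by simp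
      rw [← pr_coe b, fiber_pr hs, count_rts, count_roots] at hcount
      have h3 : 1 < (fs P Q (b, 1)).rootMultiplicity z := by omega
      rw [one_lt_rootMultiplicity_iff_isRoot (fs_ne h hd1 hs)] at h3
      obtain ⟨h4, h5⟩ := h3
      simp only [fs, IsRoot.def, eval_sub, eval_mul, eval_C, derivative_sub, derivative_mul, derivative_C] at h4 h5
      simp only [Set.mem_setOf_eq, IsRoot.def, wronskian, eval_sub, eval_mul]
      simp at h4 h5
      linear_combination (derivative Q).eval z * h4 - Q.eval z * h5
  have : ({b : ℂ | (b : Sphere) ≠ ratEval P Q ∞} ∪ {b : ℂ | (b : Sphere) = ratEval P Q ∞}).Finite := by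
    refine hfin.union (Set.Subsingleton.finite ?_)
    intro a ha b hb
    exact OnePoint.coe_injective (ha.trans hb.symm)
  refine Set.infinite_univ (α := ℂ) (this.subset fun b _ => ?_)
  by_cases hb : (b : Sphere) = ratEval P Q ∞
  · exact Or.inr hb
  · exact Or.inl hb

lemma sub_seq {s : ℕ → Sphere → Sphere} {F : Set (Sphere → Sphere)} (hs : ∀ n, s n ∈ F)
    (U K : Sphere → Set Sphere) (hU : ∀ z, NormalOn F (U z)) (hK : ∀ z, IsCompact (K z)) (hKU : ∀ z, K z ⊆ U z)
    (S : Finset Sphere) : ∃ φ : ℕ → ℕ, StrictMono φ ∧ ∀ z ∈ S, ∃ g : Sphere → Sphere, ∀ ε : ℝ, 0 < ε →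
      ∀ᶠ n in atTop, ∀ y ∈ K z, sphDist (s (φ n) y) (g y) < ε := by
  induction S using Finset.induction_on with
  | empty => exact ⟨id, strictMono_id, by simp⟩
  | insert a S _ ih =>
    obtain ⟨φ, hφ, h⟩ := ih
    obtain ⟨ψ, hψ, g, hgl⟩ := hU a (fun n => s (φ n)) (fun n => hs _)
    refine ⟨φ ∘ ψ, hφ.comp hψ, ?_⟩
    intro z hz
    rcases Finset.mem_insert.1 hz with rfl | hz
    · exact ⟨g, fun ε hε => hgl (K z) (hKU z) (hK z) ε hε⟩
    · obtain ⟨g', hg'⟩ := h z hz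
      exact ⟨g', fun ε hε => hψ.tendsto_atTop.eventually (hg' ε hε)⟩

lemma julia_ne (hg : Good p q) : (juliaSet p q).Nonempty := by
  obtain ⟨i, hi⟩ := hg.2.2.2
  set w : ℕ → Fin N := fun _ => i with hw
  suffices h : (juliaW p q w).Nonempty by
    obtain ⟨z, hz⟩ := h
    exact ⟨(w, z), subset_closure (Set.mem_iUnion.2 ⟨w, by simpa using hz⟩)⟩
  by_contra hne
  rw [Set.not_nonempty_iff_eq_empty] at hne
  have hF : ∀ z, z ∈ fatouW p q w := by
    intro z
    by_contra hz
    have : z ∈ juliaW p q w := hz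
    rw [hne] at this; exact this
  have hit : ∀ n, itComp p q w n = (ratEval (p i) (q i))^[n] := by
    intro n
    induction n with
    | zero => rfl
    | succ n ih => rw [itComp, ih, Function.iterate_succ']
  set R := ratEval (p i) (q i) with hR
  choose U hU hzU hN using hF
  choose K hK hzK hKU using fun z => exists_compact_subset (hU z) (hzU z)
  obtain ⟨S, hS⟩ := isCompact_univ.elim_nhds_subcover (fun z => interior (K z))
    (fun z _ => isOpen_interior.mem_nhds (hzK z))
  obtain ⟨φ, hφ, hconv⟩ := sub_seq (F := {g | ∃ n, 1 ≤ n ∧ g = itComp p q w n}) (s := fun n => itComp p q w (n + 1)) (fun n => ⟨n + 1, by omega, rfl⟩) U K hN hK hKU S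
  obtain ⟨u, v, huv, hRuv⟩ := not_inj (hg.cop i) hi
  have hε : 0 < sphDist u v / 4 := by have := sph_pos huv; positivity
  choose! g hgl using hconv
  have hev : ∀ᶠ n in atTop, ∀ z ∈ S, ∀ y ∈ K z, sphDist (itComp p q w (φ n + 1) y) (g z y) < sphDist u v / 4 := by
    rw [Filter.eventually_all_finset]
    exact fun z hz => hgl z hz _ hε
  obtain ⟨M, hM⟩ := hev.exists_forall_of_atTop
  have hlt : φ M < φ (M + 1) := hφ (Nat.lt_succ_self M)
  obtain ⟨m, hm⟩ : ∃ m, φ (M + 1) + 1 = (m + 1) + (φ M + 1) := ⟨φ (M+1) - φ M - 1, by omega⟩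
  have hcl : ∀ y, sphDist y (R^[m + 1] y) < sphDist u v / 2 := by
    intro y
    obtain ⟨x, rfl⟩ := (ratEval_surj (hg.cop i) (hg.deg i)).iterate (φ M + 1) y
    have hx := hS.2 (Set.mem_univ x)
    simp only [Set.mem_iUnion] at hx
    obtain ⟨z, hz, hx⟩ := hx
    have h1 := hM M le_rfl z hz x (interior_subset hx)
    have h2 := hM (M + 1) (by omega) z hz x (interior_subset hx)
    rw [hit] at h1 h2
    rw [hm, Function.iterate_add_apply] at h2
    have h3 := sph_tri (R^[φ M + 1] x) (g z x) (R^[m + 1] (R^[φ M + 1] x))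
    rw [sph_comm (g z x)] at h3
    linarith
  have h1 := hcl u
  have h2 := hcl v
  have e : R^[m + 1] u = R^[m + 1] v := by
    rw [Function.iterate_succ_apply, Function.iterate_succ_apply, hR, hRuv]
  rw [e] at h1
  have h3 := sph_tri u (R^[m + 1] v) v
  rw [sph_comm (R^[m + 1] v) v] at h3
  linarith


/-! ### Support -/
lemma normal_of_equi {f : ℕ → Sphere → Sphere} (hf : ∀ n, Continuous (f n)) {K : Set Sphere} (hK : IsCompact K)
    (h : ∀ y ∈ K, ∀ ε : ℝ, 0 < ε → ∃ V ∈ 𝓝 y, ∀ n, ∀ x ∈ V, dist (emb (f n x)) (emb (f n y)) < ε) :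
    NormalOn {g | ∃ n, 1 ≤ n ∧ g = f n} (interior K) := by
  intro s hs
  haveI : CompactSpace K := isCompact_iff_compactSpace.1 hK
  choose k _ hk using hs
  let G : ℕ → BoundedContinuousFunction K (WithLp 2 (ℂ × ℝ)) := fun n =>
    BoundedContinuousFunction.mkOfCompact ⟨fun x => emb (f n x), emb_cont.comp ((hf n).comp continuous_subtype_val)⟩
  have hr : IsCompact (Set.range emb) := isCompact_range emb_cont
  have hc := BoundedContinuousFunction.arzela_ascoli (Set.range emb) hr (Set.range G)
    (by rintro _ x ⟨n, rfl⟩; exact ⟨_, rfl⟩)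
    (by
      intro y
      rw [Metric.equicontinuousAt_iff_right]
      intro ε hε
      obtain ⟨V, hV, h1⟩ := h y y.2 ε hε
      filter_upwards [continuous_subtype_val.continuousAt.preimage_mem_nhds hV] with x hx
      rintro ⟨_, n, rfl⟩
      have := h1 n x hx
      rw [dist_comm] at this
      exact this)
  obtain ⟨g, _, φ, hφ, hlim⟩ := hc.tendsto_subseq (x := fun n => G (k n)) (fun n => subset_closure ⟨_, rfl⟩)
  have hgr : ∀ x : K, ∃ y, emb y = g x := by
    intro x
    show g x ∈ Set.range emb
    refine hr.isClosed.mem_of_tendsto (b := atTop) (f := fun n => G (k (φ n)) x) ?_ (Eventually.of_forall fun n => ⟨_, rfl⟩)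
    exact ((BoundedContinuousFunction.lipschitz_eval_const x).continuous.tendsto g).comp hlim
  choose l hl using hgr
  refine ⟨φ, hφ, fun y => if hy : y ∈ K then l ⟨y, hy⟩ else y, ?_⟩
  intro K' hK' _ ε hε
  filter_upwards [(Metric.tendsto_nhds.1 hlim) ε hε] with n hn z hz
  have hz' : z ∈ K := interior_subset (hK' hz)
  simp only [dif_pos hz', sphDist_eq, hl, hk]
  exact (BoundedContinuousFunction.dist_coe_le_dist (f := G (k (φ n))) (g := g) ⟨z, hz'⟩).trans_lt hn

lemma homE_diff (d : ℕ) (P : ℂ[X]) {A B : ℂ → ℂ} (hA : Differentiable ℂ A) (hB : Differentiable ℂ B) :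
    Differentiable ℂ fun t => homE d P (A t, B t) := by
  unfold homE
  fun_prop

lemma lift (hg : Good p q) (w : ℕ → Fin N) (c : ℂ → Sphere) (hc : ∃ A B : ℂ → ℂ, Differentiable ℂ A ∧ Differentiable ℂ B ∧
    ∀ t, (A t, B t) ≠ (0 : ℂ × ℂ) ∧ c t = pr (A t, B t)) (n : ℕ) : ∃ A B : ℂ → ℂ, Differentiable ℂ A ∧ Differentiable ℂ B ∧
    ∀ t, (A t, B t) ≠ (0 : ℂ × ℂ) ∧ itComp p q w n (c t) = pr (A t, B t) := by
  induction n with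
  | zero => exact hc
  | succ n ih =>
    obtain ⟨A, B, hA, hB, h⟩ := ih
    refine ⟨_, _, homE_diff (max (p (w n)).natDegree (q (w n)).natDegree) (p (w n)) hA hB, homE_diff (max (p (w n)).natDegree (q (w n)).natDegree) (q (w n)) hA hB, fun t => ?_⟩
    have h1 := ratEval_pr (hg.cop (w n)) (hg.deg (w n)) (h t).1
    refine ⟨h1.1, ?_⟩
    rw [← h1.2, ← (h t).2]; rfl

lemma mob_tendsto (e2 a k : ℂ) : Tendsto (fun t : ℂ => pr (t * e2 - a, t - k)) (cocompact ℂ) (𝓝 (pr (e2, 1))) := by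
  have h0 : Tendsto (fun t : ℂ => t⁻¹) (cocompact ℂ) (𝓝 0) := by
    rw [← Metric.cobounded_eq_cocompact]; exact tendsto_inv₀_cobounded
  have h1 : Tendsto (fun t : ℂ => ((e2 - a * t⁻¹, 1 - k * t⁻¹) : ℂ × ℂ)) (cocompact ℂ) (𝓝 (e2, 1)) := by
    have : Tendsto (fun s : ℂ => ((e2 - a * s, 1 - k * s) : ℂ × ℂ)) (𝓝 0) (𝓝 (e2, 1)) := by
      have : Continuous (fun s : ℂ => ((e2 - a * s, 1 - k * s) : ℂ × ℂ)) := by fun_prop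
      simpa using this.tendsto 0
    exact this.comp h0
  have h2 := (pr_contAt (s := (e2, 1)) (by simp)).tendsto.comp h1
  refine h2.congr' ?_
  have hne : ∀ᶠ t : ℂ in cocompact ℂ, t ≠ 0 := by
    have := (isCompact_singleton (x := (0:ℂ))).compl_mem_cocompact
    filter_upwards [this] with t ht using ht
  filter_upwards [hne] with t ht
  have := pr_smul ht (e2 - a * t⁻¹, 1 - k * t⁻¹)
  simp only [Function.comp]
  rw [← this]
  congr 2 <;> field_simp

lemma equi_chart (hg : Good p q) (w : ℕ → Fin N) (c : ℂ → Sphere) (hc : ∃ A B : ℂ → ℂ, Differentiable ℂ A ∧ Differentiable ℂ B ∧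
    ∀ t, (A t, B t) ≠ (0 : ℂ × ℂ) ∧ c t = pr (A t, B t)) (hco : IsOpenMap c)
    {U : Set Sphere} {k : ℕ} {e1 e2 e3 : ℂ} (h12 : e1 ≠ e2) (h13 : e1 ≠ e3) (h23 : e2 ≠ e3)
    (h : ∀ n, k ≤ n → ∀ x ∈ U, itComp p q w n x ≠ e1 ∧ itComp p q w n x ≠ e2 ∧ itComp p q w n x ≠ e3)
    {a : ℂ} {r : ℝ} (hr : 0 < r) (har : ∀ t ∈ Metric.ball a r, c t ∈ U) {ε : ℝ} (hε : 0 < ε) :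
    ∃ V ∈ 𝓝 (c a), ∀ n, ∀ x ∈ V, dist (emb (itComp p q w n x)) (emb (itComp p q w n (c a))) < ε := by
  set l : ℂ := (e3 - e2) / (e3 - e1) with hl
  have h31 : e3 - e1 ≠ 0 := sub_ne_zero.2 h13.symm
  have h32 : e3 - e2 ≠ 0 := sub_ne_zero.2 h23.symm
  have h12' : e1 - e2 ≠ 0 := sub_ne_zero.2 h12
  have hl0 : l ≠ 0 := div_ne_zero h32 h31
  have hl1 : l * (e3 - e1) = e3 - e2 := by rw [hl]; field_simp
  have hMne : ∀ t : ℂ, ((t * e2 - l * e1, t - l) : ℂ × ℂ) ≠ 0 := by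
    intro t ht
    rw [Prod.mk_eq_zero] at ht
    have : t = l := sub_eq_zero.1 ht.2
    rw [this, ← mul_sub] at ht
    exact (mul_ne_zero hl0 (sub_ne_zero.2 h12.symm)) ht.1
  have hMc : Continuous fun t : ℂ => emb (pr (t * e2 - l * e1, t - l)) := by
    refine emb_cont.comp (continuous_iff_continuousAt.2 fun t => ?_)
    exact ContinuousAt.comp (f := fun t : ℂ => ((t * e2 - l * e1, t - l) : ℂ × ℂ)) (pr_contAt (hMne t)) (by fun_prop)
  have hMt := (emb_cont.tendsto _).comp (mob_tendsto e2 (l * e1) l)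
  obtain ⟨δ, hδ, hM⟩ := montel_equi _ hMc _ hMt hr hε
  have hfin : ∀ n, {x | dist (emb (itComp p q w n x)) (emb (itComp p q w n (c a))) < ε} ∈ 𝓝 (c a) := by
    intro n
    have hcn : Continuous fun x => dist (emb (itComp p q w n x)) (emb (itComp p q w n (c a))) :=
      (emb_cont.comp (itComp_cont hg w n)).dist continuous_const
    exact (isOpen_lt hcn continuous_const).mem_nhds (by simpa using hε)
  refine ⟨c '' Metric.ball a (min δ r) ∩ ⋂ n ∈ Finset.range k, {x | dist (emb (itComp p q w n x)) (emb (itComp p q w n (c a))) < ε},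
    inter_mem (hco.image_mem_nhds (Metric.ball_mem_nhds _ (lt_min hδ hr))) ((Filter.biInter_finset_mem _).2 fun n _ => hfin n), ?_⟩
  rintro n x ⟨⟨t, ht, rfl⟩, hx⟩
  rcases lt_or_ge n k with hn | hn
  · exact Set.mem_iInter₂.1 hx n (Finset.mem_range.2 hn)
  obtain ⟨A, B, hA, hB, hAB⟩ := lift hg w c hc n
  have homit : ∀ t ∈ Metric.ball a r, A t - e1 * B t ≠ 0 ∧ A t - e2 * B t ≠ 0 ∧ A t - e3 * B t ≠ 0 := by
    intro t ht
    have h1 := h n hn (c t) (har t ht)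
    rw [(hAB t).2, ← pr_coe e1, ← pr_coe e2, ← pr_coe e3] at h1
    rw [Ne, Ne, Ne, pr_eq_iff (hAB t).1 (by simp), pr_eq_iff (hAB t).1 (by simp), pr_eq_iff (hAB t).1 (by simp)] at h1
    refine ⟨fun h => h1.1 ?_, fun h => h1.2.1 ?_, fun h => h1.2.2 ?_⟩ <;> linear_combination -h
  set f : ℂ → ℂ := fun t => l * (A t - e1 * B t) / (A t - e2 * B t) with hf
  have hrec : ∀ t ∈ Metric.ball a r, itComp p q w n (c t) = pr (f t * e2 - l * e1, f t - l) := by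
    intro t ht
    rw [(hAB t).2, pr_eq_iff (hAB t).1 (hMne _)]
    have := (homit t ht).2.1
    have hft : f t * (A t - e2 * B t) = l * (A t - e1 * B t) := div_mul_cancel₀ _ this
    linear_combination -hft
  have htr : t ∈ Metric.ball a r := Metric.ball_subset_ball (min_le_right _ _) ht
  rw [hrec t htr, hrec a (Metric.mem_ball_self hr)]
  refine hM a f ?_ ?_ ?_ t ((Metric.mem_ball.1 ht).trans_le (min_le_left _ _))
  · intro s hs
    have := (homit s hs).2.1
    exact (DifferentiableAt.div (c := fun t => l * (A t - e1 * B t)) (d := fun t => A t - e2 * B t) (by fun_prop) (by fun_prop) this).differentiableWithinAt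
  · intro s hs
    exact div_ne_zero (mul_ne_zero hl0 (homit s hs).1) (homit s hs).2.1
  · intro s hs h1
    rw [hf] at h1
    simp only at h1
    rw [div_eq_one_iff_eq (homit s hs).2.1] at h1
    have h3 : (e1 - e2) * (A s - e3 * B s) = 0 := by
      linear_combination (e3 - e1) * h1 - (A s - e1 * B s) * hl1
    exact mul_ne_zero h12' (homit s hs).2.2 h3

lemma chart_ex (z : Sphere) : ∃ c : ℂ → Sphere, (∃ A B : ℂ → ℂ, Differentiable ℂ A ∧ Differentiable ℂ B ∧
    ∀ t, (A t, B t) ≠ (0 : ℂ × ℂ) ∧ c t = pr (A t, B t)) ∧ IsOpenMap c ∧ Continuous c ∧ ∃ t, c t = z := by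
  induction z using OnePoint.rec with
  | coe a =>
    refine ⟨fun t => (t : Sphere), ⟨fun t => t, fun _ => 1, by fun_prop, by fun_prop, fun t => ⟨by simp, (pr_coe t).symm⟩⟩,
      OnePoint.isOpenEmbedding_coe.isOpenMap, OnePoint.continuous_coe, a, rfl⟩
  | infty =>
    have h1 : IsCoprime (1 : ℂ[X]) X := isCoprime_one_left
    have h2 : 1 ≤ max (1 : ℂ[X]).natDegree (X : ℂ[X]).natDegree := by simp
    refine ⟨fun t => ratEval 1 X (t : Sphere), ⟨fun _ => 1, fun t => t, by fun_prop, by fun_prop, fun t => ⟨by simp, ?_⟩⟩,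
      (ratEval_open h1 h2).comp OnePoint.isOpenEmbedding_coe.isOpenMap, (ratEval_cont h1 h2).comp OnePoint.continuous_coe, 0, ?_⟩
    · simp [ratEval, pr]
    · simp [ratEval]

lemma fatou_of_omit (hg : Good p q) (w : ℕ → Fin N) {U : Set Sphere} (hU : IsOpen U) {k : ℕ} {e1 e2 e3 : ℂ}
    (h12 : e1 ≠ e2) (h13 : e1 ≠ e3) (h23 : e2 ≠ e3)
    (h : ∀ n, k ≤ n → ∀ x ∈ U, itComp p q w n x ≠ e1 ∧ itComp p q w n x ≠ e2 ∧ itComp p q w n x ≠ e3)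
    {z : Sphere} (hz : z ∈ U) : z ∈ fatouW p q w := by
  obtain ⟨c, hc, hco, hcc, a, rfl⟩ := chart_ex z
  obtain ⟨r, hr, hball⟩ := Metric.isOpen_iff.1 (hU.preimage hcc) a hz
  obtain ⟨K, hK, hzK, hKU⟩ := exists_compact_subset (hco _ (Metric.isOpen_ball (x := a) (ε := r / 2)))
    (show c a ∈ _ from ⟨a, Metric.mem_ball_self (by positivity), rfl⟩)
  refine ⟨interior K, isOpen_interior, hzK, normal_of_equi (fun n => itComp_cont hg w n) hK ?_⟩
  intro y hy ε hε
  obtain ⟨b, hb, rfl⟩ := hKU hy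
  refine equi_chart hg w c hc hco h12 h13 h23 h (r := r / 2) (by positivity) ?_ hε
  intro t ht
  apply hball
  rw [Metric.mem_ball] at *
  linarith [dist_triangle t b a]

lemma cyl_null (hg : Good p q) {J : Set (SymX N)} (hJn : J.Nonempty) {μ : Measure (SymX N)} [IsProbabilityMeasure μ]
    (hμ : LimM p q J μ) (k : ℕ) : ∀ (w : ℕ → Fin N) (B : Set Sphere), IsOpen B →
    μ ({w' | ∀ j < k, w' j = w j} ×ˢ B) = 0 → μ (Set.univ ×ˢ (itComp p q w k '' B)) = 0 := by
  induction k with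
  | zero =>
    intro w B _ h
    simpa [itComp] using h
  | succ k ih =>
    intro w B hB h
    rw [itComp_succ', Set.image_comp]
    refine ih _ _ (ratEval_open (hg.cop _) (hg.deg _) _ hB) ?_
    have ho : IsOpen ({w' : ℕ → Fin N | ∀ j < k + 1, w' j = w j} ×ˢ B) := by
      refine IsOpen.prod ?_ hB
      have : {w' : ℕ → Fin N | ∀ j < k + 1, w' j = w j} = ⋂ j ∈ Finset.range (k + 1), {w' | w' j = w j} := by
        ext; simp
      rw [this]
      refine isOpen_biInter_finset fun j _ => ?_
      exact (isOpen_discrete ({w j} : Set (Fin N))).preimage (f := fun w' : ℕ → Fin N => w' j) (continuous_apply j)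
    refine measure_mono_null ?_ (null_image hg hJn hμ ho h)
    rintro ⟨v, y⟩ ⟨hv, x, hx, rfl⟩
    refine ⟨(consW (w 0) v, x), ⟨?_, hx⟩, ?_⟩
    · intro j hj
      rcases j with _ | j
      · exact cons_zero (w 0) v
      · have := hv j (by omega)
        simpa [consW, shiftW] using this
    · simp [Tmap, shift_cons, cons_zero]

/-- The open set of points with a null neighbourhood (projected to the sphere). -/
def OO (μ : Measure (SymX N)) : Set Sphere := {x | ∃ W : Set Sphere, IsOpen W ∧ x ∈ W ∧ μ (Set.univ ×ˢ W) = 0}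

lemma OO_fwd (hg : Good p q) {J : Set (SymX N)} (hJn : J.Nonempty) {μ : Measure (SymX N)} [IsProbabilityMeasure μ]
    (hμ : LimM p q J μ) (i : Fin N) {x : Sphere} (hx : x ∈ OO μ) : ratEval (p i) (q i) x ∈ OO μ := by
  obtain ⟨W, hW, hxW, h0⟩ := hx
  refine ⟨_, ratEval_open (hg.cop i) (hg.deg i) W hW, ⟨x, hxW, rfl⟩, ?_⟩
  have := cyl_null hg hJn hμ 1 (fun _ => i) W hW (measure_mono_null (Set.prod_mono (Set.subset_univ _) subset_rfl) h0)
  exact this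

lemma E_finite_false (hg : Good p q) (hA1 : NoSuperAttract p q) {E : Set Sphere} (hE : E.Finite)
    (hEb : ∀ i x, ratEval (p i) (q i) x ∈ E → x ∈ E) {w : ℕ → Fin N} {e : Sphere} (he : e ∈ E)
    (hJ : (w, e) ∈ juliaSet p q) : False := by
  obtain ⟨i, hi⟩ := hg.2.2.2
  set R := ratEval (p i) (q i) with hR
  have hs := ratEval_surj (hg.cop i) (hg.deg i)
  choose g hgR using hs
  have hgE : Set.MapsTo g E E := fun x hx => hEb i _ (by rw [hgR]; exact hx)
  have hgi : Set.InjOn g E := fun x _ y _ h => by rw [← hgR x, ← hgR y, h]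
  have hgs : Set.SurjOn g E E := ((hE.injOn_iff_bijOn_of_mapsTo hgE).1 hgi).surjOn
  have hRE : ∀ x ∈ E, R x ∈ E := by
    intro x hx
    obtain ⟨y, hy, rfl⟩ := hgs hx
    rw [hR, hgR]; exact hy
  have hRi : ∀ x y, R x ∈ E → R x = R y → x = y := by
    intro x y hx h
    obtain ⟨x', _, rfl⟩ := hgs (hEb i x hx)
    obtain ⟨y', _, rfl⟩ := hgs (hEb i y (by rw [← hR, ← h]; exact hx))
    rw [hR, hgR, hgR] at h
    rw [h]
  have hper : ∃ m, 1 ≤ m ∧ R^[m] e = e := by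
    have hmem : ∀ n, R^[n] e ∈ E := by
      intro n
      induction n with
      | zero => exact he
      | succ n ih => rw [Function.iterate_succ_apply']; exact hRE _ ih
    have hc : ∀ a b, R^[a] e = R^[a + b] e → e = R^[b] e := by
      intro a b
      induction a with
      | zero => intro h; simpa using h
      | succ a ih =>
        intro h
        apply ih
        rw [show a + 1 + b = (a + b) + 1 by ring, Function.iterate_succ_apply', Function.iterate_succ_apply'] at h
        exact hRi _ _ (hRE _ (hmem a)) h
    obtain ⟨a, _, b, _, hab, h⟩ := Set.infinite_univ.exists_lt_map_eq_of_mapsTo (f := fun n : ℕ => R^[n] e) (fun n _ => hmem n) hE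
    obtain ⟨d, rfl⟩ := Nat.exists_eq_add_of_lt hab
    exact ⟨d + 1, by omega, (hc a (d + 1) h).symm⟩
  obtain ⟨m, hm, hme⟩ := hper
  have hback : ∀ n (e : Sphere), (w, R^[n] e) ∈ juliaSet p q → ((consW i)^[n] w, e) ∈ juliaSet p q := by
    intro n
    induction n with
    | zero => intro e h; exact h
    | succ n ih =>
      intro e h
      apply julia_back hg
      rw [Function.iterate_succ_apply'] 
      simp only [Tmap, shift_cons, cons_zero]
      exact ih _ h
  have hit : ∀ n (w : ℕ → Fin N), ∀ j < n, (consW i)^[n] w j = i := by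
    intro n
    induction n with
    | zero => intro w j hj; omega
    | succ n ih =>
      intro w j hj
      rw [Function.iterate_succ_apply']
      rcases j with _ | j
      · exact cons_zero _ _
      · simpa [consW] using ih w j (by omega)
  have hlim : ((fun _ => i, e) : SymX N) ∈ juliaSet p q := by
    have hcl : IsClosed (juliaSet p q) := isClosed_closure
    refine hcl.mem_of_tendsto (b := atTop) (f := fun n : ℕ => (((consW i)^[m * n] w, e) : SymX N)) ?_ (Eventually.of_forall fun n => ?_)
    · refine Tendsto.prodMk_nhds ?_ tendsto_const_nhds
      rw [tendsto_pi_nhds]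
      intro j
      refine tendsto_const_nhds.congr' ?_
      filter_upwards [eventually_gt_atTop j] with n hn
      rw [hit _ _ j (by nlinarith)]
    · apply hback
      rw [Function.iterate_mul, Function.iterate_fixed hme]
      exact hJ
  have hTm : ∀ n x, (Tmap p q)^[n] ((fun _ => i, x) : SymX N) = (fun _ => i, R^[n] x) := by
    intro n
    induction n with
    | zero => intro x; rfl
    | succ n ih => intro x; rw [Function.iterate_succ_apply, Function.iterate_succ_apply, ← ih]; rfl
  refine hA1 _ hlim m hm (by rw [hTm, hme]) 0 (by omega) ?_
  show 2 ≤ (fiber (p i) (q i) (R e)).count e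
  have : (fiber (p i) (q i) (R e)).count e = (fiber (p i) (q i) (R e)).card := by
    rw [Multiset.count_eq_card]
    intro x hx
    have hx' := (mem_fiber (hg.cop i) (hg.deg i) _ _).1 hx
    exact hRi _ _ (hRE e he) hx'.symm
  rw [this, card_fiber]
  exact hi

lemma supp_sub (hg : Good p q) (hA1 : NoSuperAttract p q) {μ : Measure (SymX N)} [IsProbabilityMeasure μ]
    (hμ : LimM p q (juliaSet p q) μ) (hJ0 : μ (juliaSet p q)ᶜ = 0) {x : SymX N} (hx : x ∈ juliaSet p q)
    {U : Set (SymX N)} (hU : IsOpen U) (hxU : x ∈ U) : 0 < μ U := by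
  by_contra hpos
  have h0 : μ U = 0 := by simpa using hpos
  have hJn : (juliaSet p q).Nonempty := ⟨x, hx⟩
  obtain ⟨⟨w, z⟩, hwU, hwJ⟩ := mem_closure_iff.1 hx U hU hxU
  have hzJ : z ∈ juliaW p q w := by
    simp only [Set.mem_iUnion, Set.mem_prod, Set.mem_singleton_iff] at hwJ
    obtain ⟨w', rfl, h⟩ := hwJ
    exact h
  obtain ⟨u, B, hu, hB, hwu, hzB, huB⟩ := isOpen_prod_iff.1 hU w z hwU
  obtain ⟨I, v, hv, hI⟩ := isOpen_pi_iff.1 hu w hwu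
  set k := I.sup id + 1 with hk
  have hcyl : μ ({w' | ∀ j < k, w' j = w j} ×ˢ B) = 0 := by
    refine measure_mono_null (Set.Subset.trans (Set.prod_mono ?_ subset_rfl) huB) h0
    intro w' hw'
    apply hI
    intro j hj
    have : j ≤ I.sup id := Finset.le_sup (f := id) hj
    rw [hw' j (by omega)]
    exact (hv j hj).2
  have h1 := cyl_null hg hJn hμ k w B hB hcyl
  have hop : IsOpen (itComp p q w k '' B) := by
    have : ∀ n, IsOpenMap (itComp p q w n) := by
      intro n
      induction n with
      | zero => exact IsOpenMap.id
      | succ n ih => exact (ratEval_open (hg.cop _) (hg.deg _)).comp ih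
    exact this k _ hB
  have hO : ∀ n, k ≤ n → ∀ x ∈ B, itComp p q w n x ∈ OO μ := by
    intro n hn x hx
    induction n, hn using Nat.le_induction with
    | base => exact ⟨_, hop, ⟨x, hx, rfl⟩, h1⟩
    | succ n _ ih => exact OO_fwd hg hJn hμ (w n) ih
  by_cases hfin : (OO μ)ᶜ.Finite
  · have hex : ∃ y ∈ juliaSet p q, y.2 ∉ OO μ := by
      by_contra hall
      push Not at hall
      have hJ : μ (juliaSet p q) = 0 := by
        refine measure_null_of_locally_null _ fun y hy => ?_
        obtain ⟨W, hW, hyW, hW0⟩ := hall y hy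
        exact ⟨_, mem_nhdsWithin_of_mem_nhds ((isOpen_univ.prod hW).mem_nhds ⟨trivial, hyW⟩), hW0⟩
      have : μ Set.univ = 0 := by
        rw [← Set.union_compl_self (juliaSet p q)]
        exact measure_union_null hJ hJ0
      simp at this
    obtain ⟨⟨w', e⟩, hy, he⟩ := hex
    exact E_finite_false hg hA1 hfin (fun i x hx hx' => hx (OO_fwd hg hJn hμ i hx')) he hy
  · have hinf : {b : ℂ | (b : Sphere) ∈ (OO μ)ᶜ}.Infinite := by
      intro hf
      apply hfin
      refine ((hf.image fun b : ℂ => (b : Sphere)).insert (OnePoint.infty : Sphere)).subset ?_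
      intro y hy
      induction y using OnePoint.rec with
      | infty => exact Or.inl rfl
      | coe b => exact Or.inr ⟨b, hy, rfl⟩
    obtain ⟨t, ht, hcard⟩ := hinf.exists_subset_card_eq 3
    obtain ⟨e1, e2, e3, h12, h13, h23, rfl⟩ := Finset.card_eq_three.1 hcard
    refine hzJ (fatou_of_omit hg w hB (k := k) h12 h13 h23 ?_ hzB)
    intro n hn x hx
    have hx := hO n hn x hx
    have a1 := ht (show e1 ∈ _ by simp)
    have a2 := ht (show e2 ∈ _ by simp)
    have a3 := ht (show e3 ∈ _ by simp)
    refine ⟨fun h => a1 (h ▸ hx), fun h => a2 (h ▸ hx), fun h => a3 (h ▸ hx)⟩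

lemma main_thm (hg : Good p q) (hA1 : NoSuperAttract p q) :
    ∀ μ : Measure (SymX N), IsProbabilityMeasure μ →
      (∀ x ∈ juliaSet p q, ∀ g : C(SymX N, ℝ),
        Tendsto (fun n : ℕ =>
            ((Dtot p q : ℝ) ^ n)⁻¹ * ((preimTn p q n x).map fun y => g y).sum)
          atTop (𝓝 (∫ y, g y ∂μ))) →
      (∀ A : Set (SymX N), MeasurableSet A → μ (Tmap p q ⁻¹' A) = μ A) ∧
      (∀ A : Set (SymX N), MeasurableSet A → Tmap p q ⁻¹' A = A → μ A = 0 ∨ μ A = 1) ∧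
      (∀ x : SymX N, μ {x} = 0) ∧
      {x : SymX N | ∀ U : Set (SymX N), IsOpen U → x ∈ U → 0 < μ U} = juliaSet p q := by
  intro μ hP hlim
  have hμ : LimM p q (juliaSet p q) μ := by
    intro x hx g hgc
    have := hlim x hx ⟨g, hgc⟩
    simpa only [SS_n hg, ContinuousMap.coe_mk] using this
  have hJn := julia_ne hg
  have hJc : IsClosed (juliaSet p q) := isClosed_closure
  have hJ0 := J0_of hg hJc hJn (julia_back hg) hμ
  refine ⟨fun A hA => inv_of hg hJn hμ hA, fun A hA hT => erg_of hg hJn hμ hJ0 hA hT, ?_, ?_⟩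
  · intro x
    refine nonatomic_of hg hJn hμ hJ0 ?_ x
    intro y hy m hm hT
    have h := hA1 y hy m hm hT 0 (by omega)
    exact not_le.1 h
  · ext x
    constructor
    · intro h
      by_contra hx
      have := h _ hJc.isOpen_compl hx
      rw [hJ0] at this
      exact lt_irrefl _ this
    · intro hx U hU hxU
      exact supp_sub hg hA1 hμ hJ0 hx hU hxU

end Helpers

theorem limit_measure_invariant_ergodic_nonatomic
    (hg : Good p q) (hA1 : NoSuperAttract p q) :
    ∀ μ : Measure (SymX N), IsProbabilityMeasure μ →
      (∀ x ∈ juliaSet p q, ∀ g : C(SymX N, ℝ),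
        Tendsto (fun n : ℕ =>
            ((Dtot p q : ℝ) ^ n)⁻¹ * ((preimTn p q n x).map fun y => g y).sum)
          atTop (𝓝 (∫ y, g y ∂μ))) →
      (∀ A : Set (SymX N), MeasurableSet A → μ (Tmap p q ⁻¹' A) = μ A) ∧
      (∀ A : Set (SymX N), MeasurableSet A → Tmap p q ⁻¹' A = A → μ A = 0 ∨ μ A = 1) ∧
      (∀ x : SymX N, μ {x} = 0) ∧
      {x : SymX N | ∀ U : Set (SymX N), IsOpen U → x ∈ U → 0 < μ U} = juliaSet p q := by
  exact main_thm hg hA1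

end SkewRational
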